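/- arXiv:1706.08804 — 3 statements merged into one kernel-verified Lean document; each statement's English description precedes it below -/
import Mathlib

section
/- Let M = (M_p) be a logarithmically convex sequence of positive reals with M_0 = 1, whose quotients m_p := M_{p+1}/M_p tend to infinity, and which admits a nonzero proximate order, and let γ > 0. Suppose f is holomorphic in a sectorial region G_γ, bounded in every proper bounded subsector T ≪ G_γ, and admits a formal power series f̂ = Σ_{n≥0} a_n z^n as its M-asymptotic expansion in some direction θ ∈ (−πγ/2, πγ/2). Then f admits f̂ as its M-asymptotic expansion in the whole region G_γ, i.e., f ∈ Ã_M(G_γ) and f ∼_M f̂ in G_γ. -/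
open Filter Topology Set
open scoped Real

noncomputable section

/-!
We model functions on (subsets of) the Riemann surface of the logarithm through the
logarithmic chart: a point `z = e^w` of the Riemann surface (with modulus `|z| = exp (Re w)`
and argument `arg z = Im w`) corresponds to the point `w : ℂ`.  A holomorphic function `f`
on a sector corresponds to the holomorphic function `w ↦ f (e^w)` on the corresponding
horizontal strip, and `z → 0` corresponds to `Re w → -∞`.
-/

/-- `M` is a sequence of positive reals with `M 0 = 1`, logarithmically convex,
whose sequence of quotients `m p = M (p+1) / M p` tends to infinity. -/
def GoodSeq (M : ℕ → ℝ) : Prop :=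
  M 0 = 1 ∧ (∀ p, 0 < M p) ∧ (∀ p : ℕ, (M (p + 1)) ^ 2 ≤ M p * M (p + 2)) ∧
    Tendsto (fun p : ℕ => M (p + 1) / M p) atTop atTop

/-- The associated function `M(t) = sup_p log (t^p / M_p)`. -/
def assocM (M : ℕ → ℝ) (t : ℝ) : ℝ := ⨆ p : ℕ, Real.log (t ^ p / M p)

/-- The index `ω(M) = liminf_p log (m_p) / log p`. -/
def omegaM (M : ℕ → ℝ) : ℝ :=
  Filter.liminf (fun p : ℕ => Real.log (M (p + 1) / M p) / Real.log (p : ℝ)) atTop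

/-- `ρ` is a proximate order on `(c, ∞)` with limit `ℓ` at infinity:  continuous and
piecewise continuously differentiable (differentiable except possibly on a set `E` of points
that is finite below any bound, at each of which it has distinct finite lateral derivatives),
nonnegative, with `ρ(r) → ℓ` and `r ρ'(r) log r → 0` as `r → ∞`. -/
def IsProximateOrder (c : ℝ) (ρ : ℝ → ℝ) (ℓ : ℝ) : Prop :=
  ContinuousOn ρ (Ioi c) ∧ (∀ r ∈ Ioi c, 0 ≤ ρ r) ∧ Tendsto ρ atTop (𝓝 ℓ) ∧
    ∃ (E : Set ℝ) (ρ' : ℝ → ℝ),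
      (∀ R : ℝ, (E ∩ Iic R).Finite) ∧
      (∀ r ∈ Ioi c \ E, HasDerivAt ρ (ρ' r) r) ∧
      ContinuousOn ρ' (Ioi c \ E) ∧
      (∀ r ∈ E ∩ Ioi c, ∃ dl dr : ℝ, dl ≠ dr ∧
        HasDerivWithinAt ρ dl (Iio r) r ∧ HasDerivWithinAt ρ dr (Ioi r) r) ∧
      Tendsto (fun r => r * ρ' r * Real.log r) (atTop ⊓ 𝓟 (Ioi c \ E)) (𝓝 0)

/-- The sequence `M` admits a nonzero proximate order: there are a nonzero proximate order
`ρ(t)` and constants `A ≤ B` with `A ≤ log t · (ρ(t) − d_M(t)) ≤ B` for `t` large,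
where `d_M(t) = log M(t) / log t`. -/
def AdmitsNonzeroProximateOrder (M : ℕ → ℝ) : Prop :=
  ∃ (c ℓ : ℝ) (ρ : ℝ → ℝ), 0 < ℓ ∧ IsProximateOrder c ρ ℓ ∧
    ∃ A B : ℝ, ∀ᶠ t in atTop,
      A ≤ Real.log t * (ρ t - Real.log (assocM M t) / Real.log t) ∧
      Real.log t * (ρ t - Real.log (assocM M t) / Real.log t) ≤ B

/-- The unbounded open sector `S(d, γ)` (bisecting direction `d`, opening `γπ`),
in the logarithmic chart. -/
def logSector (d γ : ℝ) : Set ℂ := {w : ℂ | |w.im - d| < γ * π / 2}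

/-- The bounded open sector `S(d, γ, R)` (radius `R`), in the logarithmic chart. -/
def logSectorB (d γ R : ℝ) : Set ℂ :=
  {w : ℂ | |w.im - d| < γ * π / 2 ∧ w.re < Real.log R}

/-- The closure of `S(d, γ, R)` in the Riemann surface of the logarithm
(the vertex is not present), in the logarithmic chart. -/
def logSectorC (d γ R : ℝ) : Set ℂ :=
  {w : ℂ | |w.im - d| ≤ γ * π / 2 ∧ w.re ≤ Real.log R}

/-- `G` is a sectorial region `G(d, γ)`: an open connected subset of `S(d, γ)` that,
for every `0 < β < γ`, contains a bounded sector `S(d, β, ρ)`. -/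
def SectorialRegion (d γ : ℝ) (G : Set ℂ) : Prop :=
  IsOpen G ∧ IsConnected G ∧ G ⊆ logSector d γ ∧
    ∀ β : ℝ, 0 < β → β < γ → ∃ ρ : ℝ, 0 < ρ ∧ logSectorB d β ρ ⊆ G

/-- The bounded sector `S(d, β, r)` is a proper subsector of `G` (written `T ≪ G`):
its closure in the Riemann surface of the logarithm is contained in `G`. -/
def ProperSubsector (G : Set ℂ) (d β r : ℝ) : Prop :=
  0 < β ∧ 0 < r ∧ logSectorC d β r ⊆ G

/-- `f` (defined on `D`) is `M`-flat in the direction `θ`: there are `r, C, A > 0` such that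
the segment `(0, r e^{iθ}]` lies in `D` and `|f(z)| ≤ C A^p M_p |z|^p` on it, for all `p`. -/
def MFlatDir (M : ℕ → ℝ) (f : ℂ → ℂ) (D : Set ℂ) (θ : ℝ) : Prop :=
  ∃ r C A : ℝ, 0 < r ∧ 0 < C ∧ 0 < A ∧
    (∀ x : ℝ, x ≤ Real.log r → (⟨x, θ⟩ : ℂ) ∈ D) ∧
    ∀ x : ℝ, x ≤ Real.log r → ∀ p : ℕ,
      ‖f ⟨x, θ⟩‖ ≤ C * A ^ p * M p * Real.exp x ^ p

/-- `f` (bounded, defined on `D`) is Beurling `M`-flat in the direction `θ`. -/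
def BeurlingFlatDir (M : ℕ → ℝ) (f : ℂ → ℂ) (D : Set ℂ) (θ : ℝ) : Prop :=
  ∀ c2 : ℝ, 0 < c2 → ∃ c1 : ℝ, 0 < c1 ∧
    ∀ w ∈ D, w.im = θ →
      ‖f w‖ ≤ c1 * Real.exp (-assocM M (1 / (c2 * Real.exp w.re)))

/-- `f` admits `Σ a_n z^n` as its `M`-asymptotic expansion in the region `G`:  on every
proper subsector `T ≪ G` there are `C, A > 0` with
`|f(z) − Σ_{n<p} a_n z^n| ≤ C A^p M_p |z|^p` for all `z ∈ T`, `p ∈ ℕ`.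
(In the logarithmic chart, `z = e^w`.) -/
def AsympExpandsOn (M : ℕ → ℝ) (f : ℂ → ℂ) (a : ℕ → ℂ) (G : Set ℂ) : Prop :=
  ∀ d β r : ℝ, ProperSubsector G d β r → ∃ C A : ℝ, 0 < C ∧ 0 < A ∧
    ∀ w ∈ logSectorB d β r, ∀ p : ℕ,
      ‖f w - ∑ n ∈ Finset.range p, a n * Complex.exp w ^ n‖
        ≤ C * A ^ p * M p * Real.exp w.re ^ p

/-- `f` admits `Σ a_n z^n` as its `M`-asymptotic expansion in the direction `θ`: there are
`r, C, A > 0` such that the segment `(0, r e^{iθ}]` lies in `G` and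
`|f(z) − Σ_{n<p} a_n z^n| ≤ C A^p M_p |z|^p` on it, for all `p`. -/
def AsympExpandsDir (M : ℕ → ℝ) (f : ℂ → ℂ) (a : ℕ → ℂ) (G : Set ℂ) (θ : ℝ) : Prop :=
  ∃ r C A : ℝ, 0 < r ∧ 0 < C ∧ 0 < A ∧
    (∀ x : ℝ, x ≤ Real.log r → (⟨x, θ⟩ : ℂ) ∈ G) ∧
    ∀ x : ℝ, x ≤ Real.log r → ∀ p : ℕ,
      ‖f (⟨x, θ⟩ : ℂ) - ∑ n ∈ Finset.range p, a n * Complex.exp (⟨x, θ⟩ : ℂ) ^ n‖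
        ≤ C * A ^ p * M p * Real.exp x ^ p

/-- The derivative with respect to the base variable `z = e^w`, in the logarithmic chart:
`(d/dz) f = e^{-w} (d/dw) f`. -/
def zderiv (f : ℂ → ℂ) : ℂ → ℂ := fun w => Complex.exp (-w) * deriv f w

/-- The filter of approach to the vertex (`z → 0`, i.e. `Re w → -∞`) within `D`. -/
def vertexFilter (D : Set ℂ) : Filter ℂ := Filter.comap Complex.re atBot ⊓ 𝓟 D

/-- The class `Ã^u_M(S)` contains no nontrivial function whose uniform `M`-asymptotic
expansion on `S` is the null power series. -/
def UniformQuasianalytic (M : ℕ → ℝ) (S : Set ℂ) : Prop :=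
  ∀ f : ℂ → ℂ, DifferentiableOn ℂ f S →
    (∃ C A : ℝ, 0 < C ∧ 0 < A ∧
      ∀ w ∈ S, ∀ p : ℕ, ‖f w‖ ≤ C * A ^ p * M p * Real.exp w.re ^ p) →
    ∀ w ∈ S, f w = 0


lemma lc_ratio {v : ℕ → ℝ} (hv : ∀ p, 0 < v p) (hlc : ∀ p, (v (p+1))^2 ≤ v p * v (p+2)) :
    Monotone (fun n => v (n+1) / v n) := by
  apply monotone_nat_of_le_succ
  intro n
  rw [div_le_div_iff₀ (hv _) (hv _)]
  nlinarith [hlc n]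

/-- a log-convex sequence is minimal where two consecutive terms agree -/
lemma lc_min {v : ℕ → ℝ} (hv : ∀ p, 0 < v p) (hlc : ∀ p, (v (p+1))^2 ≤ v p * v (p+2))
    (N : ℕ) (hN : v (N+1) = v N) (n : ℕ) : v N ≤ v n := by
  have hr := lc_ratio hv hlc
  have h1 : v (N+1) / v N = 1 := by rw [hN]; exact div_self (hv N).ne'
  rcases le_total N n with h | h
  · induction n, h using Nat.le_induction with
    | base => exact le_rfl
    | succ m hm ih =>
      have := hr hm
      simp only [h1] at this
      rw [le_div_iff₀ (hv m)] at this
      linarith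
  · induction h using Nat.decreasingInduction with
    | self => exact le_rfl
    | of_succ m hm ih =>
      have := hr (le_of_lt hm)
      simp only [h1] at this
      rw [div_le_iff₀ (hv m)] at this
      linarith

lemma lc_max {v : ℕ → ℝ} (hv : ∀ p, 0 < v p) (hlc : ∀ p, (v (p+1))^2 ≤ v p * v (p+2))
    {i n p : ℕ} (hin : i ≤ n) (hnp : n ≤ p) : v n ≤ max (v i) (v p) := by
  have hr := lc_ratio hv hlc
  rcases le_total 1 (v (n+1) / v n) with h | h
  · apply le_max_of_le_right
    induction p, hnp using Nat.le_induction with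
    | base => exact le_rfl
    | succ m hm ih =>
      have h2 := h.trans (hr hm)
      simp only at h2
      rw [le_div_iff₀ (hv m)] at h2
      linarith
  · apply le_max_of_le_left
    induction hin using Nat.decreasingInduction with
    | self => exact le_rfl
    | of_succ m hm ih =>
      have h2 := (hr (le_of_lt hm)).trans h
      simp only at h2
      rw [div_le_iff₀ (hv m)] at h2
      linarith

lemma lc_scale {M : ℕ → ℝ} (hM : GoodSeq M) {t : ℝ} (ht : 0 < t) :
    (∀ p, 0 < t^p * M p) ∧ ∀ p, (t^(p+1) * M (p+1))^2 ≤ (t^p * M p) * (t^(p+2) * M (p+2)) := by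
  refine ⟨fun p => mul_pos (pow_pos ht p) (hM.2.1 p), fun p => ?_⟩
  have := mul_le_mul_of_nonneg_left (hM.2.2.1 p) (pow_pos ht (2*p+2)).le
  calc _ = t^(2*p+2) * M (p+1)^2 := by ring
    _ ≤ _ := this
    _ = _ := by ring

lemma quot_max {M : ℕ → ℝ} (hM : GoodSeq M) (N n : ℕ) :
    (M (N+1) / M N)^n / M n ≤ (M (N+1) / M N)^N / M N := by
  have hm : 0 < M (N+1) / M N := div_pos (hM.2.1 _) (hM.2.1 _)
  obtain ⟨h1, h2⟩ := lc_scale hM (inv_pos.2 hm)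
  have := lc_min h1 h2 N (by
    have := (hM.2.1 N).ne'
    have := (hM.2.1 (N+1)).ne'
    rw [pow_succ]; field_simp) n
  have h3 := inv_anti₀ (h1 N) this
  simp only [mul_inv, inv_pow, inv_inv] at h3
  simpa only [div_eq_mul_inv] using h3

lemma M_ge {M : ℕ → ℝ} (hM : GoodSeq M) (n : ℕ) : M 1 ^ n ≤ M n := by
  have := quot_max hM 0 n
  simp [hM.1] at this
  rwa [div_le_one (hM.2.1 n)] at this

lemma bdd_assoc {M : ℕ → ℝ} (hM : GoodSeq M) {t : ℝ} (ht : 0 < t) :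
    BddAbove (range fun p : ℕ => Real.log (t^p / M p)) := by
  obtain ⟨N, hN⟩ := (hM.2.2.2.eventually_ge_atTop t).exists
  refine ⟨Real.log ((M (N+1) / M N)^N / M N), ?_⟩
  rintro _ ⟨p, rfl⟩
  apply Real.log_le_log (div_pos (pow_pos ht p) (hM.2.1 p))
  refine le_trans ?_ (quot_max hM N p)
  have := hM.2.1 p
  gcongr

lemma le_assoc {M : ℕ → ℝ} (hM : GoodSeq M) {t : ℝ} (ht : 0 < t) (p : ℕ) :
    Real.log (t^p / M p) ≤ assocM M t := le_ciSup (bdd_assoc hM ht) p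

lemma assoc_quot {M : ℕ → ℝ} (hM : GoodSeq M) (N : ℕ) :
    assocM M (M (N+1) / M N) ≤ Real.log ((M (N+1) / M N)^N / M N) := by
  apply ciSup_le
  intro p
  have hm : 0 < M (N+1) / M N := div_pos (hM.2.1 _) (hM.2.1 _)
  exact Real.log_le_log (div_pos (pow_pos hm p) (hM.2.1 p)) (quot_max hM N p)

lemma le_of_deriv_off_finite (g g' : ℝ → ℝ) (S : Finset ℝ) : ∀ a b : ℝ, a ≤ b →
    ContinuousOn g (Icc a b) → (∀ x ∈ Ioo a b, x ∉ S → HasDerivAt g (g' x) x ∧ 0 ≤ g' x) →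
    g a ≤ g b := by
  induction S using Finset.induction_on with
  | empty =>
    intro a b hab hc hd
    have : MonotoneOn g (Icc a b) := by
      apply monotoneOn_of_deriv_nonneg (convex_Icc a b) hc
      · rw [interior_Icc]
        intro x hx
        exact (hd x hx (by simp)).1.differentiableAt.differentiableWithinAt
      · rw [interior_Icc]
        intro x hx
        rw [(hd x hx (by simp)).1.deriv]
        exact (hd x hx (by simp)).2
    exact this ⟨le_rfl, hab⟩ ⟨hab, le_rfl⟩ hab
  | insert e S he ih =>
    intro a b hab hc hd
    by_cases h : e ∈ Ioo a b
    · refine (ih a e h.1.le (hc.mono (Icc_subset_Icc_right h.2.le)) ?_).trans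
        (ih e b h.2.le (hc.mono (Icc_subset_Icc_left h.1.le)) ?_)
      · intro x hx hxS
        exact hd x ⟨hx.1, hx.2.trans h.2⟩ (by simp [hxS, hx.2.ne])
      · intro x hx hxS
        exact hd x ⟨h.1.trans hx.1, hx.2⟩ (by simp [hxS, hx.1.ne'])
    · refine ih a b hab hc ?_
      intro x hx hxS
      refine hd x hx ?_
      simp only [Finset.mem_insert, not_or]
      exact ⟨fun hxe => h (hxe ▸ hx), hxS⟩

lemma prox_growth {c ℓ : ℝ} {ρ : ℝ → ℝ} (hℓ : 0 < ℓ) (h : IsProximateOrder c ρ ℓ) :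
    ∀ᶠ t in atTop, ∀ u, t ≤ u →
      Real.log t * (ρ t - ℓ/2) ≤ Real.log u * (ρ u - ℓ/2) := by
  obtain ⟨hc, -, hlim, E, ρ', hE, hd, -, -, h0⟩ := h
  have e1 : ∀ᶠ r in atTop, r ∈ Ioi c \ E → -(ℓ/8) < r * ρ' r * Real.log r := by
    have := h0.eventually (lt_mem_nhds (show -(ℓ/8) < 0 by linarith))
    rwa [eventually_inf_principal] at this
  have e2 : ∀ᶠ r in atTop, ℓ - ℓ/8 < ρ r := hlim.eventually (lt_mem_nhds (by linarith))
  obtain ⟨T, hT⟩ := eventually_atTop.1 (e1.and (e2.and (eventually_gt_atTop (max c 1))))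
  filter_upwards [eventually_ge_atTop T] with t ht u htu
  have key : ∀ x, t ≤ x → c < x ∧ 1 < x := fun x hx =>
    ⟨(le_max_left _ _).trans_lt (hT x (ht.trans hx)).2.2,
      (le_max_right _ _).trans_lt (hT x (ht.trans hx)).2.2⟩
  refine le_of_deriv_off_finite (fun x => Real.log x * (ρ x - ℓ/2))
    (fun x => x⁻¹ * (ρ x - ℓ/2) + Real.log x * ρ' x) (hE u).toFinset t u htu ?_ ?_
  · apply ContinuousOn.mul
    · apply Real.continuousOn_log.mono
      intro x hx
      have := (key x hx.1).2
      simp; linarith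
    · exact (hc.mono fun x hx => (key x hx.1).1).sub continuousOn_const
  · intro x hx hxE
    have hxE' : x ∈ Ioi c \ E := by
      refine ⟨(key x hx.1.le).1, fun hh => hxE ?_⟩
      simp [hh, hx.2.le]
    have hx1 := (key x hx.1.le).2
    have hx0 : 0 < x := by linarith
    refine ⟨(Real.hasDerivAt_log hx0.ne').mul ((hd x hxE').sub_const _), ?_⟩
    have h1 := (hT x (ht.trans hx.1.le)).1 hxE'
    have h2 := (hT x (ht.trans hx.1.le)).2.1
    have : x⁻¹ * (ρ x - ℓ/2) + Real.log x * ρ' x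
        = x⁻¹ * (ρ x - ℓ/2 + x * ρ' x * Real.log x) := by field_simp
    rw [this]
    apply mul_nonneg (inv_nonneg.2 hx0.le); linarith

lemma assoc_double {M : ℕ → ℝ} (hM : GoodSeq M) (hPO : AdmitsNonzeroProximateOrder M) :
    ∃ H : ℝ, 1 ≤ H ∧ ∀ᶠ t in atTop, 2 * assocM M t ≤ assocM M (H * t) := by
  obtain ⟨c, ℓ, ρ, hℓ, hρ, A, B, hAB⟩ := hPO
  set κ := max 0 ((B - A + Real.log 2) * 2 / ℓ) with hκ
  have hκ0 : 0 ≤ κ := le_max_left _ _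
  have hH : 1 ≤ Real.exp κ := Real.one_le_exp hκ0
  refine ⟨Real.exp κ, hH, ?_⟩
  have hHt : Tendsto (fun t => Real.exp κ * t) atTop atTop :=
    tendsto_id.const_mul_atTop (Real.exp_pos κ)
  filter_upwards [hAB, hHt.eventually hAB, prox_growth hℓ hρ, eventually_gt_atTop 1,
    eventually_gt_atTop (M 1)] with t h1 h2 h3 h4 h5
  have h0 : 0 < t := by linarith
  have hg := h3 (Real.exp κ * t) (by nlinarith)
  have hl : Real.log (Real.exp κ * t) = κ + Real.log t := by
    rw [Real.log_mul (Real.exp_pos κ).ne' h0.ne', Real.log_exp]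
  have hlt : 0 < Real.log t := Real.log_pos h4
  have e : ∀ s, 0 < s → ∀ x y : ℝ, s * (x - y / s) = s * x - y := by
    intro s hs x y; field_simp
  rw [hl] at h2 hg
  rw [e _ hlt] at h1
  rw [e _ (by linarith)] at h2
  have p1 : 0 < assocM M t := by
    refine lt_of_lt_of_le ?_ (le_assoc hM h0 1)
    apply Real.log_pos
    rw [pow_one, one_lt_div (hM.2.1 1)]; exact h5
  have p2 : 0 < assocM M (Real.exp κ * t) := by
    refine lt_of_lt_of_le ?_ (le_assoc hM (by positivity) 1)
    apply Real.log_pos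
    rw [pow_one, one_lt_div (hM.2.1 1)]; nlinarith
  have hk : B - A + Real.log 2 ≤ κ * (ℓ/2) := by
    have := le_max_right 0 ((B - A + Real.log 2) * 2 / ℓ)
    rw [← hκ, div_le_iff₀ hℓ] at this
    linarith
  rw [← Real.log_le_log_iff (by positivity) p2, Real.log_mul (by norm_num) p1.ne']
  nlinarith [h1.1, h1.2, h2.1, h2.2]

lemma M_double {M : ℕ → ℝ} (hM : GoodSeq M) (hPO : AdmitsNonzeroProximateOrder M) :
    ∃ c : ℝ, 1 ≤ c ∧ ∀ p, M (2*p) ≤ c^p * M p ^ 2 := by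
  obtain ⟨H, hH, hev⟩ := assoc_double hM hPO
  have hH0 : 0 < H := by linarith
  have t1 : Tendsto (fun p : ℕ => M (2*p+1) / M (2*p) / H) atTop atTop :=
    (hM.2.2.2.comp (tendsto_id.const_mul_atTop' (by norm_num : 0 < 2))).atTop_div_const hH0
  obtain ⟨P, hP⟩ := eventually_atTop.1 (t1.eventually hev)
  have hq : ∀ p, 0 ≤ M (2*p) / M p ^ 2 := fun p =>
    div_nonneg (hM.2.1 _).le (sq_nonneg _)
  set s := ∑ p ∈ Finset.range P, M (2*p) / M p ^ 2 with hs
  have hs0 : 0 ≤ s := Finset.sum_nonneg fun p _ => hq p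
  refine ⟨H^2 + s, by nlinarith, fun p => ?_⟩
  have hMp := hM.2.1 p
  rcases lt_or_ge p P with h | h
  · rcases Nat.eq_zero_or_pos p with rfl | hp
    · simp [hM.1]
    rw [← div_le_iff₀ (by positivity)]
    have h1 : M (2*p) / M p ^ 2 ≤ s :=
      Finset.single_le_sum (f := fun p => M (2*p) / M p ^ 2) (fun p _ => hq p)
        (Finset.mem_range.2 h)
    have h2 : H^2 + s ≤ (H^2+s)^p := le_self_pow₀ (by nlinarith) hp.ne'
    nlinarith
  · have h1 := hP p h
    set T := M (2*p+1) / M (2*p) with hT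
    have hT0 : 0 < T := div_pos (hM.2.1 _) (hM.2.1 _)
    rw [mul_div_cancel₀ _ hH0.ne'] at h1
    have h2 := assoc_quot hM (2*p)
    rw [← hT] at h2
    have h3 := le_assoc hM (div_pos hT0 hH0) p
    have h4 : 2 * Real.log ((T/H)^p / M p) ≤ Real.log (T^(2*p) / M (2*p)) := by linarith
    have h5 : Real.log (((T/H)^p / M p)^2) ≤ Real.log (T^(2*p) / M (2*p)) := by
      rw [Real.log_pow]; exact_mod_cast h4
    have hM2 := hM.2.1 (2*p)
    rw [Real.log_le_log_iff (by positivity) (by positivity)] at h5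
    have h6 : M (2*p) ≤ (H^2)^p * M p^2 := by
      have e : ((T/H)^p / M p)^2 = T^(2*p) / ((H^2)^p * M p^2) := by
        rw [div_pow, div_pow, div_pow, ← pow_mul, ← pow_mul, ← pow_mul, mul_comm p 2]
        field_simp
      rw [e, div_le_div_iff_of_pos_left (by positivity) (by positivity) (by positivity)] at h5
      exact h5
    refine h6.trans ?_
    gcongr
    linarith

lemma M_mul {M : ℕ → ℝ} (hM : GoodSeq M) (hPO : AdmitsNonzeroProximateOrder M) (j : ℕ) :
    ∃ c : ℝ, 1 ≤ c ∧ ∀ p, M (2^j*p) ≤ (c^p * M p) ^ (2^j) := by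
  obtain ⟨c, hc, h⟩ := M_double hM hPO
  induction j with
  | zero => exact ⟨1, le_rfl, by simp⟩
  | succ j ih =>
    obtain ⟨c', hc', h'⟩ := ih
    refine ⟨c * c', one_le_mul_of_one_le_of_one_le hc hc', fun p => ?_⟩
    have hp := (hM.2.1 p).le
    calc M (2^(j+1)*p) = M (2*(2^j*p)) := by congr 1; ring
      _ ≤ c^(2^j*p) * M (2^j*p)^2 := h _
      _ ≤ c^(2^(j+1)*p) * ((c'^p * M p)^(2^j))^2 := by
        have := (hM.2.1 (2^j*p)).le
        have h8 : 2^j*p ≤ 2^(j+1)*p := by rw [pow_succ]; nlinarith [Nat.zero_le (2^j*p)]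
        have := h' p
        gcongr
      _ = _ := by rw [← pow_mul, ← pow_succ, mul_pow c c', mul_assoc, mul_pow (c^p), ← pow_mul c p, mul_comm p]

open Complex in
lemma PL_half (g : ℂ → ℂ) {a b X P Q q : ℝ} (hab : a < b) (hP : 0 < P)
    (hd : DifferentiableOn ℂ g {w | w.re ≤ X ∧ a ≤ w.im ∧ w.im ≤ b})
    (ha : ∀ w : ℂ, w.re ≤ X → w.im = a → ‖g w‖ ≤ P)
    (hb : ∀ w : ℂ, w.re ≤ X → w.im = b → ‖g w‖ ≤ P)
    (hX : ∀ w : ℂ, w.re = X → a ≤ w.im → w.im ≤ b → ‖g w‖ ≤ P)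
    (hQ : ∀ w : ℂ, w.re ≤ X → a ≤ w.im → w.im ≤ b → ‖g w‖ ≤ Q * Real.exp (-q * w.re))
    (w : ℂ) (hwX : w.re ≤ X) (hwa : a ≤ w.im) (hwb : w.im ≤ b) : ‖g w‖ ≤ P := by
  have hnorm : ∀ (ε : ℝ) (z : ℂ), ‖cexp (-ε * (z - a * I)^2)‖
      = Real.exp (ε * ((z.im - a)^2 - z.re^2)) := by
    intro ε z
    rw [Complex.norm_exp]
    congr 1
    simp [pow_two]
    ring
  have key : ∀ ε : ℝ, 0 < ε → ‖g w‖ * Real.exp (ε * ((w.im - a)^2 - w.re^2))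
      ≤ P * Real.exp (ε * (b-a)^2) := by
    intro ε hε
    have hbound : ∀ z : ℂ, a ≤ z.im → z.im ≤ b → ‖g z‖ ≤ P →
        ‖g z * cexp (-ε * (z - a * I)^2)‖ ≤ P * Real.exp (ε * (b-a)^2) := by
      intro z h1 h2 h3
      rw [norm_mul, hnorm]
      have : (z.im - a)^2 - z.re^2 ≤ (b-a)^2 := by nlinarith [sq_nonneg z.re]
      gcongr
    have hlim : Tendsto (fun x : ℝ => Q * Real.exp (-(x * (q + ε * x)))) atBot (𝓝 (Q * 0)) := by
      apply Tendsto.const_mul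
      apply Real.tendsto_exp_neg_atTop_nhds_zero.comp
      apply tendsto_id.atBot_mul_atBot₀
      exact tendsto_atBot_add_const_left _ _ (tendsto_id.const_mul_atBot hε)
    rw [mul_zero] at hlim
    obtain ⟨x1, hx1, hx1w⟩ := ((hlim.eventually (gt_mem_nhds hP)).and
      (eventually_lt_atBot w.re)).exists
    have hx1X : x1 < X := hx1w.trans_le hwX
    have hcl : closure (Ioo x1 X ×ℂ Ioo a b) = Icc x1 X ×ℂ Icc a b := by
      rw [closure_reProdIm, closure_Ioo hx1X.ne, closure_Ioo hab.ne]
    have := norm_le_of_forall_mem_frontier_norm_le (f := fun z => g z * cexp (-ε * (z - a * I)^2))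
      (U := Ioo x1 X ×ℂ Ioo a b) (C := P * Real.exp (ε * (b-a)^2)) (z := w)
      ((Metric.isBounded_Ioo _ _).reProdIm (Metric.isBounded_Ioo _ _)) ?_ ?_ ?_
    · rwa [norm_mul, hnorm] at this
    · apply DifferentiableOn.diffContOnCl
      rw [hcl]
      apply DifferentiableOn.mul
      · apply hd.mono
        intro z hz
        exact ⟨hz.1.2, hz.2.1, hz.2.2⟩
      · apply Differentiable.differentiableOn
        fun_prop
    · intro z hz
      rw [frontier_reProdIm, closure_Ioo hx1X.ne, closure_Ioo hab.ne, frontier_Ioo hx1X,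
        frontier_Ioo hab] at hz
      rcases hz with ⟨h1, h2⟩ | ⟨h1, h2⟩
      · rcases h2 with h2 | h2
        · exact hbound z (le_of_eq h2.symm) (by rw [h2]; exact hab.le) (ha z h1.2 h2)
        · have h2 : z.im = b := h2
          exact hbound z (by rw [h2]; exact hab.le) (le_of_eq h2) (hb z h1.2 h2)
      · have h2a : a ≤ z.im := h2.1
        have h2b : z.im ≤ b := h2.2
        rcases h1 with h1 | h1
        · have h1 : z.re = x1 := h1
          have hq := hQ z (by rw [h1]; exact hx1X.le) h2a h2b
          rw [norm_mul, hnorm]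
          have hQ0 : 0 ≤ Q * Real.exp (-q * z.re) := (norm_nonneg _).trans hq
          calc _ ≤ Q * Real.exp (-q * z.re) * Real.exp (ε * ((z.im - a)^2 - z.re^2)) := by gcongr
            _ = Q * Real.exp (-(x1 * (q + ε * x1))) * Real.exp (ε * (z.im - a)^2) := by
              rw [h1, mul_assoc, mul_assoc, ← Real.exp_add, ← Real.exp_add]; congr 2; ring
            _ ≤ P * Real.exp (ε * (b-a)^2) := by
              have : (z.im - a)^2 ≤ (b-a)^2 := by nlinarith
              gcongr
        · exact hbound z h2a h2b (hX z h1 h2a h2b)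
    · rw [hcl]
      exact ⟨⟨hx1w.le, hwX⟩, hwa, hwb⟩
  have c1 : Tendsto (fun ε : ℝ => ‖g w‖ * Real.exp (ε * ((w.im - a)^2 - w.re^2))) (𝓝[>] 0)
      (𝓝 (‖g w‖ * Real.exp (0 * ((w.im - a)^2 - w.re^2)))) := by
    apply tendsto_nhdsWithin_of_tendsto_nhds
    exact Continuous.tendsto (by fun_prop) 0
  have c2 : Tendsto (fun ε : ℝ => P * Real.exp (ε * (b-a)^2)) (𝓝[>] 0)
      (𝓝 (P * Real.exp (0 * (b-a)^2))) := by
    apply tendsto_nhdsWithin_of_tendsto_nhds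
    exact Continuous.tendsto (by fun_prop) 0
  have := le_of_tendsto_of_tendsto c1 c2 (by
    filter_upwards [self_mem_nhdsWithin] with ε hε using key ε hε)
  simpa using this

open Complex in
/-- interpolation in a half strip, between the lines `Im w = θ` and `Im w = θ'` -/
lemma interp_half (R : ℂ → ℂ) {θ θ' X P l q : ℝ} (hne : θ ≠ θ') (hP : 0 < P) (hq : 0 ≤ q)
    (hX : l + q * X = 0)
    (hd : DifferentiableOn ℂ R {w | w.re ≤ X ∧ min θ θ' ≤ w.im ∧ w.im ≤ max θ θ'})
    (h1 : ∀ w : ℂ, w.re ≤ X → w.im = θ → ‖R w‖ ≤ P * Real.exp (l + q * w.re))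
    (h2 : ∀ w : ℂ, w.re ≤ X → min θ θ' ≤ w.im → w.im ≤ max θ θ' → ‖R w‖ ≤ P)
    (w : ℂ) (hwX : w.re ≤ X) (hwa : min θ θ' ≤ w.im) (hwb : w.im ≤ max θ θ') :
    ‖R w‖ ≤ P * Real.exp ((1 - (w.im - θ) / (θ' - θ)) * (l + q * w.re)) := by
  have hD : θ' - θ ≠ 0 := sub_ne_zero.2 hne.symm
  set D := θ' - θ with hDdef
  let h : ℂ → ℂ := fun z => l + q * (z - θ * I) +
    ((1/D : ℝ) : ℂ) * I * (l * (z - θ * I) + (q/2 : ℝ) * (z - θ * I)^2)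
  have hre : ∀ z, (h z).re = (1 - (z.im - θ) / D) * (l + q * z.re) := by
    intro z
    simp only [h, pow_two, add_re, mul_re, sub_re, ofReal_re, ofReal_im, I_re, I_im, mul_im,
      sub_im, add_im]
    field_simp
    ring
  have hnorm : ∀ z, ‖R z * cexp (-h z)‖
      = ‖R z‖ * Real.exp (-((1 - (z.im - θ) / D) * (l + q * z.re))) := by
    intro z
    rw [norm_mul, Complex.norm_exp, neg_re, hre]
  have hside : ∀ z : ℂ, z.re ≤ X → (z.im = θ ∨ z.im = θ') → ‖R z * cexp (-h z)‖ ≤ P := by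
    rintro z hz (h3 | h3)
    · rw [hnorm, h3, sub_self, zero_div, sub_zero, one_mul, Real.exp_neg,
        ← div_eq_mul_inv, div_le_iff₀ (Real.exp_pos _)]
      exact h1 z hz h3
    · rw [hnorm, h3, div_self hD, sub_self, zero_mul, neg_zero, Real.exp_zero, mul_one]
      exact h2 z hz (by rw [h3]; exact min_le_right _ _) (by rw [h3]; exact le_max_right _ _)
  have hfrac : ∀ y, min θ θ' ≤ y → y ≤ max θ θ' → 0 ≤ (y-θ)/D ∧ (y-θ)/D ≤ 1 := by
    intro y hy1 hy2
    rcases lt_or_gt_of_ne hne with hlt | hlt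
    · rw [min_eq_left hlt.le] at hy1
      rw [max_eq_right hlt.le] at hy2
      have : 0 < D := by linarith
      exact ⟨div_nonneg (by linarith) this.le, by rw [div_le_one this]; linarith⟩
    · rw [min_eq_right hlt.le] at hy1
      rw [max_eq_left hlt.le] at hy2
      have : D < 0 := by linarith
      exact ⟨div_nonneg_of_nonpos (by linarith) this.le, by rw [div_le_one_of_neg this]; linarith⟩
  have := PL_half (fun z => R z * cexp (-h z)) (a := min θ θ') (b := max θ θ') (X := X) (P := P)
    (Q := P * Real.exp (-l)) (q := q) (by simpa using hne.symm) hP ?_ ?_ ?_ ?_ ?_ w hwX hwa hwb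
  · rw [hnorm, Real.exp_neg, ← div_eq_mul_inv, div_le_iff₀ (Real.exp_pos _)] at this
    exact this
  · apply hd.mul
    apply Differentiable.differentiableOn
    fun_prop
  · intro z hz hz2
    apply hside z hz
    rw [hz2]
    exact min_choice θ θ'
  · intro z hz hz2
    apply hside z hz
    rw [hz2]
    exact max_choice θ θ'
  · intro z hz hz2 hz3
    rw [hnorm, hz, hX, mul_zero, neg_zero, Real.exp_zero, mul_one]
    exact h2 z hz.le hz2 hz3
  · intro z hz hz2 hz3
    rw [hnorm, mul_assoc, ← Real.exp_add]
    have := h2 z hz hz2 hz3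
    obtain ⟨f1, f2⟩ := hfrac z.im hz2 hz3
    have hneg : l + q * z.re ≤ 0 := by nlinarith
    have : -((1 - (z.im - θ) / D) * (l + q * z.re)) ≤ -l + -q * z.re := by nlinarith
    gcongr

lemma coeff_bound {M : ℕ → ℝ} {f : ℂ → ℂ} {a : ℕ → ℂ} {θ x0 C A : ℝ}
    (h : ∀ x : ℝ, x ≤ x0 → ∀ p : ℕ,
      ‖f (⟨x, θ⟩ : ℂ) - ∑ n ∈ Finset.range p, a n * Complex.exp (⟨x, θ⟩ : ℂ) ^ n‖
        ≤ C * A ^ p * M p * Real.exp x ^ p) (n : ℕ) : ‖a n‖ ≤ C * A^n * M n := by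
  have hlim : Tendsto (fun x : ℝ => C * A^n * M n + C * A^(n+1) * M (n+1) * Real.exp x) atBot
      (𝓝 (C * A^n * M n + C * A^(n+1) * M (n+1) * 0)) :=
    (Real.tendsto_exp_atBot.const_mul _).const_add _
  rw [mul_zero, add_zero] at hlim
  refine ge_of_tendsto hlim ?_
  filter_upwards [eventually_le_atBot x0] with x hx
  have h1 := h x hx n
  have h2 := h x hx (n+1)
  rw [Finset.sum_range_succ] at h2
  have h3 : ‖a n * Complex.exp (⟨x, θ⟩ : ℂ) ^ n‖ = ‖a n‖ * Real.exp x ^ n := by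
    rw [norm_mul, norm_pow, Complex.norm_exp]
  have h4 : ‖a n‖ * Real.exp x ^ n ≤ C * A ^ n * M n * Real.exp x ^ n
      + C * A ^ (n+1) * M (n+1) * Real.exp x ^ (n+1) := by
    rw [← h3]
    refine le_trans ?_ (add_le_add h1 h2)
    refine le_trans (le_of_eq ?_) (norm_sub_le _ _)
    congr 1
    ring
  have h5 : 0 < Real.exp x ^ n := pow_pos (Real.exp_pos x) n
  rw [← mul_le_mul_iff_left₀ h5]
  refine h4.trans (le_of_eq ?_)
  ring

lemma sum_bound {M : ℕ → ℝ} (hM : GoodSeq M) {a : ℕ → ℂ} {C A : ℝ} (hC : 0 < C) (hA : 0 < A)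
    (ha : ∀ n, ‖a n‖ ≤ C * A^n * M n) (w : ℂ) (i p : ℕ) :
    ‖∑ n ∈ Finset.Ico i p, a n * Complex.exp w ^ n‖ ≤
      C * p * max ((A * Real.exp w.re)^i * M i) ((A * Real.exp w.re)^p * M p) := by
  obtain ⟨h1, h2⟩ := lc_scale hM (mul_pos hA (Real.exp_pos w.re))
  set m := max ((A * Real.exp w.re)^i * M i) ((A * Real.exp w.re)^p * M p) with hm
  have hm0 : 0 < m := (h1 i).trans_le (le_max_left _ _)
  have : ∀ n ∈ Finset.Ico i p, ‖a n * Complex.exp w ^ n‖ ≤ C * m := by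
    intro n hn
    rw [Finset.mem_Ico] at hn
    rw [norm_mul, norm_pow, Complex.norm_exp]
    calc _ ≤ (C * A^n * M n) * Real.exp w.re ^ n := by
          have := ha n
          gcongr
      _ = C * ((A * Real.exp w.re)^n * M n) := by ring
      _ ≤ C * m := by
          have := lc_max h1 h2 hn.1 hn.2.le
          gcongr
  refine (norm_sum_le_of_le _ this).trans ?_
  rw [Finset.sum_const, nsmul_eq_mul, Nat.card_Ico]
  have : ((p - i : ℕ) : ℝ) ≤ p := by exact_mod_cast Nat.sub_le p i
  calc _ ≤ (p:ℝ) * (C * m) := by gcongr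
    _ = _ := by ring

lemma triv_bound {M : ℕ → ℝ} (hM : GoodSeq M) {f : ℂ → ℂ} {a : ℕ → ℂ} {C A K : ℝ}
    (hC : 0 < C) (hA : 0 < A) (hK : 0 ≤ K)
    (ha : ∀ n, ‖a n‖ ≤ C * A^n * M n) (w : ℂ) (hw : ‖f w‖ ≤ K) {p : ℕ} (hp : 1 ≤ p) :
    ‖f w - ∑ n ∈ Finset.range p, a n * Complex.exp w ^ n‖ ≤
      (K + C) * p * max 1 ((A * Real.exp w.re)^p * M p) := by
  have h := sum_bound hM hC hA ha w 0 p
  rw [← Finset.range_eq_Ico, pow_zero, hM.1, one_mul] at h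
  set m := max 1 ((A * Real.exp w.re)^p * M p) with hm
  have hm1 : 1 ≤ m := le_max_left _ _
  have hp1 : (1:ℝ) ≤ p := by exact_mod_cast hp
  have hpm : 1 ≤ p * m := one_le_mul_of_one_le_of_one_le hp1 hm1
  calc _ ≤ ‖f w‖ + ‖∑ n ∈ Finset.range p, a n * Complex.exp w ^ n‖ := norm_sub_le _ _
    _ ≤ K + C * p * m := add_le_add hw h
    _ ≤ K * (p * m) + C * p * m := by nlinarith
    _ = _ := by ring

set_option maxHeartbeats 1000000 in
/-- the key estimate between two lines -/
lemma side_bound {M : ℕ → ℝ} (hM : GoodSeq M) {f : ℂ → ℂ} {a : ℕ → ℂ} {C A K c : ℝ} {k : ℕ}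
    (hk : 1 ≤ k) (hc1 : 1 ≤ c) (hck : ∀ p, M (k*p) ≤ (c^p * M p)^k)
    (hC : 0 < C) (hA : 0 < A) (hK : 0 ≤ K)
    (ha : ∀ n, ‖a n‖ ≤ C * A^n * M n)
    {θ θ' x0 : ℝ} (hne : θ ≠ θ') (hx0 : 1 ≤ A * Real.exp x0 * M 1)
    (hd : DifferentiableOn ℂ f {w | w.re ≤ x0 ∧ min θ θ' ≤ w.im ∧ w.im ≤ max θ θ'})
    (hfK : ∀ w : ℂ, w.re ≤ x0 → min θ θ' ≤ w.im → w.im ≤ max θ θ' → ‖f w‖ ≤ K)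
    (hdir : ∀ w : ℂ, w.re ≤ x0 → w.im = θ → ∀ p : ℕ,
      ‖f w - ∑ n ∈ Finset.range p, a n * Complex.exp w ^ n‖
        ≤ C * A ^ p * M p * Real.exp w.re ^ p)
    (w : ℂ) (hwa : min θ θ' ≤ w.im) (hwb : w.im ≤ max θ θ')
    (hwk : 1 / k ≤ 1 - (w.im - θ) / (θ' - θ)) {p : ℕ} (hp : 1 ≤ p)
    (hsmall : c^p * ((A * Real.exp w.re)^p * M p) < 1) :
    ‖f w - ∑ n ∈ Finset.range p, a n * Complex.exp w ^ n‖ ≤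
      2 * (K + C) * (k * p) * (c^p * ((A * Real.exp w.re)^p * M p)) := by
  set q := k * p with hq
  have hq1 : 1 ≤ q := Nat.one_le_iff_ne_zero.2 (by positivity)
  have hqR : (0:ℝ) < q := by exact_mod_cast hq1
  have hkR : (1:ℝ) ≤ k := by exact_mod_cast hk
  have hMp := hM.2.1 p
  have hMq := hM.2.1 q
  have hM1 := hM.2.1 1
  have hpq : p ≤ q := by rw [hq]; nlinarith
  set l := Real.log (A^q * M q) with hl
  set X := -l / q with hXd
  have hX : l + q * X = 0 := by rw [hXd]; field_simp; ring
  have hexpL : ∀ x : ℝ, Real.exp (l + q * x) = (A * Real.exp x)^q * M q := by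
    intro x
    rw [Real.exp_add, hl, Real.exp_log (by positivity), Real.exp_nat_mul]
    ring
  have hXx0 : X ≤ x0 := by
    have h1 : 0 ≤ l + q * x0 := by
      rw [← Real.one_le_exp_iff, hexpL]
      calc (1:ℝ) ≤ (A * Real.exp x0 * M 1)^q := one_le_pow₀ hx0
        _ = (A * Real.exp x0)^q * M 1 ^ q := by rw [mul_pow]
        _ ≤ _ := by
          have := M_ge hM q
          gcongr
    by_contra hcon
    nlinarith
  set u := c^p * ((A * Real.exp w.re)^p * M p) with hu
  have hu0 : 0 < u := by positivity
  have hvu : (A * Real.exp w.re)^q * M q ≤ u^k := by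
    calc (A * Real.exp w.re)^q * M q ≤ (A * Real.exp w.re)^q * (c^p * M p)^k := by
          have := hck p
          gcongr
      _ = u^k := by rw [hu, hq]; ring
  set L := l + q * w.re with hL
  have hLneg : L < 0 := by
    rw [← Real.exp_lt_one_iff, hL, hexpL]
    exact hvu.trans_lt (pow_lt_one₀ hu0.le hsmall (by omega))
  have hwX : w.re ≤ X := by
    by_contra hcon
    push Not at hcon
    nlinarith
  have hLk : Real.exp (L / k) ≤ u := by
    rw [← pow_le_pow_iff_left₀ (Real.exp_pos _).le hu0.le (by omega : k ≠ 0), ← Real.exp_nat_mul,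
      mul_div_cancel₀ _ (by positivity : (k:ℝ) ≠ 0), hL, hexpL]
    exact hvu
  have hvq : (A * Real.exp w.re)^q * M q ≤ u := by
    refine le_trans ?_ hLk
    rw [← hexpL, ← hL]
    apply Real.exp_le_exp.2
    rw [le_div_iff₀ (by positivity)]
    nlinarith
  have hvp : (A * Real.exp w.re)^p * M p ≤ u := by
    rw [hu]
    exact le_mul_of_one_le_left (by positivity) (one_le_pow₀ hc1)
  have hR : ‖f w - ∑ n ∈ Finset.range q, a n * Complex.exp w ^ n‖ ≤ (K + C) * q * u := by
    have hI := interp_half (fun w => f w - ∑ n ∈ Finset.range q, a n * Complex.exp w ^ n)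
      (P := (K + C) * q) (X := X) (l := l) (q := q) hne (by positivity) hqR.le hX
      ?_ ?_ ?_ w hwX hwa hwb
    · refine hI.trans ?_
      gcongr
      refine le_trans ?_ hLk
      apply Real.exp_le_exp.2
      rw [← hL]
      have h9 := mul_le_mul_of_nonpos_right hwk hLneg.le
      calc _ ≤ 1 / (k:ℝ) * L := h9
        _ = L / k := by ring
    · apply DifferentiableOn.sub
      · exact hd.mono fun z hz => ⟨hz.1.trans hXx0, hz.2⟩
      · apply Differentiable.differentiableOn
        fun_prop
    · intro z hz hz2
      refine (hdir z (hz.trans hXx0) hz2 q).trans ?_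
      rw [hexpL]
      have h1 : C ≤ (K + C) * q := by
        have : (1:ℝ) ≤ q := by exact_mod_cast hq1
        nlinarith
      calc _ = C * ((A * Real.exp z.re)^q * M q) := by ring
        _ ≤ _ := by gcongr
    · intro z hz hz2 hz3
      have h := triv_bound hM hC hA hK ha z (hfK z (hz.trans hXx0) hz2 hz3) hq1
      have h1 : (A * Real.exp z.re)^q * M q ≤ 1 := by
        rw [← hexpL, Real.exp_le_one_iff]
        nlinarith
      rwa [max_eq_left h1, mul_one] at h
  have hS := sum_bound hM hC hA ha w p q
  have hsplit : f w - ∑ n ∈ Finset.range p, a n * Complex.exp w ^ n =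
      (f w - ∑ n ∈ Finset.range q, a n * Complex.exp w ^ n)
        + ∑ n ∈ Finset.Ico p q, a n * Complex.exp w ^ n := by
    rw [Finset.sum_Ico_eq_sub _ hpq]; ring
  rw [hsplit]
  have hqc : (k:ℝ) * p = q := by rw [hq]; push_cast; ring
  rw [hqc]
  calc _ ≤ (K + C) * q * u + C * q * u := by
        refine (norm_add_le _ _).trans (add_le_add hR (hS.trans ?_))
        have := max_le hvp hvq
        gcongr
    _ ≤ _ := by
        have : 0 ≤ K * q * u := by positivity
        nlinarith

lemma strip_in {γ : ℝ} {G : Set ℂ} (hG : SectorialRegion 0 γ G) {f : ℂ → ℂ}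
    (hbd : ∀ d β r : ℝ, ProperSubsector G d β r →
      ∃ K : ℝ, ∀ w ∈ logSectorB d β r, ‖f w‖ ≤ K) {b1 : ℝ} (hb0 : 0 ≤ b1)
    (hb1 : b1 < γ * π / 2) :
    ∃ b2 x0 K : ℝ, b1 < b2 ∧ 0 ≤ K ∧ ∀ w : ℂ, w.re ≤ x0 → |w.im| ≤ b2 → w ∈ G ∧ ‖f w‖ ≤ K := by
  obtain ⟨b4, h14, h4⟩ := exists_between hb1
  obtain ⟨b3, h13, h34⟩ := exists_between h14
  obtain ⟨b2, h12, h23⟩ := exists_between h13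
  have hpi := Real.pi_pos
  have e : ∀ b : ℝ, (2 * b / π) * π / 2 = b := by intro b; field_simp
  obtain ⟨ρ, hρ, hsub⟩ := hG.2.2.2 (2*b4/π) (div_pos (by linarith) hpi) (by
    rw [div_lt_iff₀ hpi]; linarith)
  have hin : ∀ w : ℂ, w.re < Real.log ρ → |w.im| < b4 → w ∈ G := by
    intro w h1 h2
    apply hsub
    refine ⟨?_, h1⟩
    rw [e, sub_zero]; exact h2
  have l1 : Real.log (ρ/2) < Real.log ρ := Real.log_lt_log (by positivity) (by linarith)
  have l2 : Real.log (ρ/4) < Real.log (ρ/2) := Real.log_lt_log (by positivity) (by linarith)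
  obtain ⟨K, hK⟩ := hbd 0 (2*b3/π) (ρ/2) ⟨div_pos (by linarith) hpi, by positivity, by
    rintro w ⟨h1, h2⟩
    rw [e, sub_zero] at h1
    exact hin w (by linarith) (by linarith)⟩
  refine ⟨b2, Real.log (ρ/4), max K 0, h12, le_max_right _ _, fun w h1 h2 => ⟨?_, ?_⟩⟩
  · exact hin w (by linarith) (by linarith)
  · refine le_trans (hK w ⟨?_, by linarith⟩) (le_max_left _ _)
    rw [e, sub_zero]; linarith

set_option maxHeartbeats 1000000 in
/-- Theorem 5.2 of the paper, propagation of asymptotics: if `f` is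
holomorphic in a sectorial region `G_γ`, bounded in every proper bounded subsector
`T ≪ G_γ`, and admits `f̂ = Σ a_n z^n` as `M`-asymptotic expansion in some direction
`θ ∈ (−πγ/2, πγ/2)`, then `f ∼_M f̂` in the whole of `G_γ`. -/
theorem asymptotic_expansion_extension
    (M : ℕ → ℝ) (hM : GoodSeq M) (hPO : AdmitsNonzeroProximateOrder M)
    (γ : ℝ) (hγ0 : 0 < γ) (G : Set ℂ) (hG : SectorialRegion 0 γ G)
    (f : ℂ → ℂ) (hf : DifferentiableOn ℂ f G)
    (hbd : ∀ d β r : ℝ, ProperSubsector G d β r →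
      ∃ K : ℝ, ∀ w ∈ logSectorB d β r, ‖f w‖ ≤ K)
    (a : ℕ → ℂ) (θ : ℝ) (hθ : |θ| < γ * π / 2)
    (hdir : AsympExpandsDir M f a G θ) :
    AsympExpandsOn M f a G := by
  intro d β r hT
  have hpi := Real.pi_pos
  obtain ⟨hβ, hr, hTG⟩ := hT
  obtain ⟨KT, hKT⟩ := hbd d β r ⟨hβ, hr, hTG⟩
  have hβπ : 0 < β * π / 2 := by positivity
  -- the angles of the subsector
  have hd1 : |d + β * π / 2| < γ * π / 2 := by
    have : (⟨Real.log r, d + β * π / 2⟩ : ℂ) ∈ logSectorC d β r := by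
      refine ⟨?_, le_rfl⟩
      simp only [add_sub_cancel_left]
      rw [abs_of_pos hβπ]
    have := hG.2.2.1 (hTG this)
    simpa [logSector] using this
  have hd2 : |d - β * π / 2| < γ * π / 2 := by
    have : (⟨Real.log r, d - β * π / 2⟩ : ℂ) ∈ logSectorC d β r := by
      refine ⟨?_, le_rfl⟩
      simp only [sub_sub_cancel_left, abs_neg]
      rw [abs_of_pos hβπ]
    have := hG.2.2.1 (hTG this)
    simpa [logSector] using this
  set b1 := max |θ| (max |d + β * π / 2| |d - β * π / 2|) with hb1
  have hb1γ : b1 < γ * π / 2 := max_lt hθ (max_lt hd1 hd2)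
  have hb0 : 0 ≤ b1 := (abs_nonneg θ).trans (le_max_left _ _)
  have hTb : ∀ w ∈ logSectorB d β r, |w.im| ≤ b1 := by
    intro w hw
    have h1 := abs_lt.1 hw.1
    have h2 : |d + β * π / 2| ≤ b1 := (le_max_left _ _).trans (le_max_right _ _)
    have h3 : |d - β * π / 2| ≤ b1 := (le_max_right _ _).trans (le_max_right _ _)
    rw [abs_le] at h2 h3 ⊢
    constructor <;> linarith [h1.1, h1.2, h2.1, h2.2, h3.1, h3.2]
  have hθb : |θ| ≤ b1 := le_max_left _ _
  obtain ⟨b2, x1, K1, h12, hK1, hstrip⟩ := strip_in hG hbd hb0 hb1γ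
  obtain ⟨rd, C, A0, hrd, hC, hA0, -, hdir⟩ := hdir
  set x0 := min x1 (Real.log rd) with hx0
  set K := max K1 KT with hKd
  have hK : 0 ≤ K := hK1.trans (le_max_left _ _)
  have hM1 := hM.2.1 1
  set A := max A0 (1 / (Real.exp x0 * M 1)) with hAd
  have hA : 0 < A := hA0.trans_le (le_max_left _ _)
  have hAx : 1 ≤ A * Real.exp x0 * M 1 := by
    have : 1 / (Real.exp x0 * M 1) ≤ A := le_max_right _ _
    rw [div_le_iff₀ (by positivity)] at this
    linarith
  have hdirA : ∀ x : ℝ, x ≤ x0 → ∀ p : ℕ,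
      ‖f (⟨x, θ⟩ : ℂ) - ∑ n ∈ Finset.range p, a n * Complex.exp (⟨x, θ⟩ : ℂ) ^ n‖
        ≤ C * A ^ p * M p * Real.exp x ^ p := by
    intro x hx p
    refine (hdir x (hx.trans (min_le_right _ _)) p).trans ?_
    have := (hM.2.1 p).le
    have : A0 ≤ A := le_max_left _ _
    gcongr
  have ha := coeff_bound hdirA
  -- choice of the multiplier
  obtain ⟨j, hj⟩ := pow_unbounded_of_one_lt (2 * b2 / (b2 - b1)) (one_lt_two)
  obtain ⟨c, hc1, hck⟩ := M_mul hM hPO j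
  have hk1 : 1 ≤ 2^j := Nat.one_le_two_pow
  have hb21 : 0 < b2 - b1 := by linarith
  have hkδ : 2 * b2 ≤ 2^j * (b2 - b1) := by
    rw [div_lt_iff₀ hb21] at hj; exact hj.le
  refine ⟨2 * (K + C) * 2^j, 2 * c * A, by positivity, by positivity, fun w hw p => ?_⟩
  have hfw : ‖f w‖ ≤ K := (hKT w hw).trans (le_max_right _ _)
  have h2j : (1:ℝ) ≤ 2^j := one_le_pow₀ (by norm_num)
  rcases Nat.eq_zero_or_pos p with rfl | hp
  · simp only [Finset.range_zero, Finset.sum_empty, sub_zero, pow_zero, mul_one, hM.1]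
    nlinarith
  have hMp := hM.2.1 p
  set u := c^p * ((A * Real.exp w.re)^p * M p) with hu
  have hu0 : 0 < u := by positivity
  have hp2 : (p:ℝ) ≤ 2^p := by exact_mod_cast (Nat.lt_two_pow_self).le
  have hgoal : 2 * (K + C) * 2^j * (2 * c * A)^p * M p * Real.exp w.re ^ p
      = 2 * (K + C) * (2^j * 2^p) * u := by rw [hu]; ring
  rw [hgoal]
  suffices hS : ‖f w - ∑ n ∈ Finset.range p, a n * Complex.exp w ^ n‖
      ≤ 2 * (K + C) * (2^j * p) * u by
    refine hS.trans ?_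
    gcongr
  rcases le_or_gt 1 u with hu1 | hu1
  · refine (triv_bound hM hC hA hK ha w hfw hp).trans ?_
    have hvp : (A * Real.exp w.re)^p * M p ≤ u := by
      rw [hu]
      exact le_mul_of_one_le_left (by positivity) (one_le_pow₀ hc1)
    have := max_le hu1 hvp
    calc _ ≤ (K + C) * p * u := by gcongr
      _ ≤ (2 * 2^j) * ((K + C) * p * u) := by
        apply le_mul_of_one_le_left (by positivity); linarith
      _ = _ := by ring
  · have hy := hTb w hw
    have main : ∀ θ' : ℝ, θ ≠ θ' → |θ'| ≤ b2 → min θ θ' ≤ w.im → w.im ≤ max θ θ' →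
        1 / ((2^j : ℕ) : ℝ) ≤ 1 - (w.im - θ) / (θ' - θ) →
        ‖f w - ∑ n ∈ Finset.range p, a n * Complex.exp w ^ n‖ ≤ 2 * (K + C) * (2^j * p) * u := by
      intro θ' hne hθ' hw1 hw2 hw3
      have him : ∀ z : ℂ, min θ θ' ≤ z.im → z.im ≤ max θ θ' → |z.im| ≤ b2 := by
        intro z h1 h2
        have h3 := abs_le.1 (hθb.trans h12.le)
        have h4 := abs_le.1 hθ'
        exact abs_le.2 ⟨(le_min h3.1 h4.1).trans h1, h2.trans (max_le h3.2 h4.2)⟩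
      have := side_bound (f := f) hM hk1 hc1 hck hC hA hK ha hne hAx ?_ ?_ ?_ w hw1 hw2 hw3 hp hu1
      · push_cast at this
        exact this
      · apply hf.mono
        intro z hz
        exact (hstrip z (hz.1.trans (min_le_left _ _)) (him z hz.2.1 hz.2.2)).1
      · intro z h1 h2 h3
        exact (hstrip z (h1.trans (min_le_left _ _)) (him z h2 h3)).2.trans (le_max_left _ _)
      · intro z h1 h2 p
        have := hdirA z.re h1 p
        have hz : (⟨z.re, θ⟩ : ℂ) = z := by apply Complex.ext <;> simp [h2]
        rwa [hz] at this
    have hθ2 := abs_le.1 hθb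
    have hy2 := abs_le.1 hy
    have hb2 : 0 < b2 := by linarith
    rcases le_total θ w.im with h | h
    · have hlt : θ < b2 := by linarith [hθ2.2]
      apply main b2 hlt.ne (abs_of_pos hb2).le
      · rw [min_eq_left hlt.le]; exact h
      · rw [max_eq_right hlt.le]; linarith [hy2.2]
      · have hD : 0 < b2 - θ := by linarith
        have e : 1 - (w.im - θ) / (b2 - θ) = (b2 - w.im) / (b2 - θ) := by field_simp; ring
        rw [e, div_le_div_iff₀ (by positivity) hD]
        push_cast
        have h9 : (2:ℝ)^j * (b2 - b1) ≤ 2^j * (b2 - w.im) := by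
          apply mul_le_mul_of_nonneg_left _ (by positivity)
          linarith [hy2.2]
        linarith [hθ2.1]
    · have hlt : -b2 < θ := by linarith [hθ2.1]
      apply main (-b2) hlt.ne' (by rw [abs_neg]; exact (abs_of_pos hb2).le)
      · rw [min_eq_right hlt.le]; linarith [hy2.1]
      · rw [max_eq_left hlt.le]; exact h
      · have hD : 0 < b2 + θ := by linarith
        have hD' : -b2 - θ ≠ 0 := by linarith
        have e : 1 - (w.im - θ) / (-b2 - θ) = (b2 + w.im) / (b2 + θ) := by
          rw [eq_div_iff hD.ne']; field_simp; ring
        rw [e, div_le_div_iff₀ (by positivity) hD]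
        push_cast
        have h9 : (2:ℝ)^j * (b2 - b1) ≤ 2^j * (b2 + w.im) := by
          apply mul_le_mul_of_nonneg_left _ (by positivity)
          linarith [hy2.1]
        linarith [hθ2.2]
end
end

section
/- Let M = (M_p) be a logarithmically convex sequence of positive reals with M_0 = 1 whose quotients m_p := M_{p+1}/M_p tend to infinity, and let γ > 0 and r > 0. Then the class Ã^u_M(S(0,γ,r)) of functions with uniform M-asymptotic expansion in the bounded sector S(0,γ,r) is quasianalytic if and only if the series Σ_{p≥0} (1/m_p)^{1/γ} diverges. -/
open Filter Topology Set
open scoped Real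

noncomputable section

lemma wt_log_bound {s : ℂ} (hs : 0 ≤ s.re) : ‖Complex.log (1 + s)‖ ≤ ‖s‖ := by
  have hne : ∀ x : ℂ, 0 ≤ x.re → 1 ≤ ‖1 + x‖ := fun x hx => by
    have := Complex.re_le_norm (1 + x)
    simp at this
    linarith
  have h := Convex.norm_image_sub_le_of_norm_hasDerivWithin_le (C := 1)
    (f := fun x : ℂ => Complex.log (1 + x)) (f' := fun x => 1 / (1 + x))
    (s := {x : ℂ | 0 ≤ x.re}) (x := 0) (y := s) ?_ ?_ ?_ (by simp) hs
  · simpa using h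
  · intro x hx
    refine (HasDerivAt.clog ((hasDerivAt_id x).const_add 1) ?_).hasDerivWithinAt
    left
    have : 0 ≤ x.re := hx
    simp
    linarith
  · intro x hx
    have := hne x hx
    rw [norm_div, norm_one]
    exact (div_le_one (by linarith)).2 this
  · exact convex_halfSpace_re_ge 0

lemma wt_norm_ge_one {s : ℂ} (hs : 0 ≤ s.re) : 1 ≤ ‖1 + s‖ := by
  have := Complex.re_le_norm (1 + s)
  simp at this
  linarith

lemma wt_norm_ge {s : ℂ} (hs : 0 ≤ s.re) : ‖s‖ ≤ ‖1 + s‖ := by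
  rw [← sq_le_sq₀ (norm_nonneg _) (norm_nonneg _), Complex.sq_norm, Complex.sq_norm,
    Complex.normSq_apply, Complex.normSq_apply]
  simp
  nlinarith

lemma wt_isOpen (γ r : ℝ) : IsOpen (logSectorB 0 γ r) := by
  have h1 : IsOpen {w : ℂ | |w.im - 0| < γ * π / 2} := isOpen_lt (by fun_prop) (by fun_prop)
  have h2 : IsOpen {w : ℂ | w.re < Real.log r} := isOpen_lt (by fun_prop) (by fun_prop)
  exact h1.inter h2

lemma wt_convex (γ r : ℝ) : Convex ℝ (logSectorB 0 γ r) := by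
  have : logSectorB 0 γ r = {w : ℂ | w.im < γ * π / 2} ∩ {w : ℂ | -(γ * π / 2) < w.im} ∩
      {w : ℂ | w.re < Real.log r} := by
    ext w
    simp [logSectorB, abs_lt]
    tauto
  rw [this]
  exact ((convex_halfSpace_im_lt _).inter (convex_halfSpace_im_gt _)).inter
    (convex_halfSpace_re_lt _)

lemma wt_zeta_re {γ r : ℝ} (hγ : 0 < γ) {w : ℂ} (hw : w ∈ logSectorB 0 γ r) :
    0 < (Complex.exp (-w / γ)).re := by
  rw [Complex.exp_re]
  apply mul_pos (Real.exp_pos _)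
  have h1 : (-w / (γ : ℂ)).im = -w.im / γ := by
    rw [Complex.div_ofReal_im]; simp
  rw [h1]
  obtain ⟨h, -⟩ := hw
  rw [sub_zero, abs_lt] at h
  apply Real.cos_pos_of_mem_Ioo
  constructor
  · rw [lt_div_iff₀ hγ]; nlinarith [h.2]
  · rw [div_lt_iff₀ hγ]; nlinarith [h.1]

lemma wt_M_prod {M : ℕ → ℝ} (hM : GoodSeq M) (p : ℕ) :
    ∏ k ∈ Finset.range p, (M (k + 1) / M k) = M p := by
  induction p with
  | zero => simp [hM.1]
  | succ p ih =>
    rw [Finset.prod_range_succ, ih]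
    have := hM.2.1 p
    field_simp

lemma wt_nonQA (M : ℕ → ℝ) (hM : GoodSeq M) (γ r : ℝ) (hγ0 : 0 < γ)
    (hs : Summable (fun p : ℕ => (1 / (M (p + 1) / M p)) ^ (1 / γ))) :
    ¬ UniformQuasianalytic M (logSectorB 0 γ r) := by
  intro hQ
  set c : ℕ → ℝ := fun p => (1 / (M (p + 1) / M p)) ^ (1 / γ) with hc
  have hm : ∀ k, 0 < M (k + 1) / M k := fun k => div_pos (hM.2.1 _) (hM.2.1 _)
  have hcpos : ∀ k, 0 < c k := fun k => Real.rpow_pos_of_pos (one_div_pos.2 (hm k)) _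
  set L : ℕ → ℂ → ℂ := fun k w => Complex.log (1 + (c k : ℂ) * Complex.exp (-w / γ)) with hL
  have hre : ∀ k, ∀ w ∈ logSectorB 0 γ r, 0 ≤ ((c k : ℂ) * Complex.exp (-w / γ)).re := by
    intro k w hw
    rw [Complex.re_ofReal_mul]
    exact mul_nonneg (hcpos k).le (wt_zeta_re hγ0 hw).le
  have hnormexp : ∀ w : ℂ, ‖Complex.exp (-w / γ)‖ = Real.exp (-w.re / γ) := by
    intro w
    rw [Complex.norm_exp, Complex.div_ofReal_re, Complex.neg_re]
  have hbd : ∀ k, ∀ w ∈ logSectorB 0 γ r, ‖L k w‖ ≤ c k * Real.exp (-w.re / γ) := by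
    intro k w hw
    refine (wt_log_bound (hre k w hw)).trans ?_
    rw [norm_mul, Complex.norm_real, Real.norm_of_nonneg (hcpos k).le, hnormexp]
  have hdiffL : ∀ k, DifferentiableOn ℂ (L k) (logSectorB 0 γ r) := by
    intro k w hw
    apply DifferentiableAt.differentiableWithinAt
    apply DifferentiableAt.clog (by fun_prop)
    left
    have := hre k w hw
    rw [Complex.add_re, Complex.one_re]
    linarith
  set f : ℂ → ℂ := fun w => Complex.exp (-(γ : ℂ) * ∑' k, L k w) with hf
  have hdiff : DifferentiableOn ℂ f (logSectorB 0 γ r) := by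
    intro w hw
    set U : Set ℂ := logSectorB 0 γ r ∩ {v : ℂ | w.re - 1 < v.re} with hU
    have hUo : IsOpen U := (wt_isOpen γ r).inter (isOpen_lt (by fun_prop) (by fun_prop))
    have h1 : DifferentiableOn ℂ (fun w => ∑' k, L k w) U := by
      apply Complex.differentiableOn_tsum_of_summable_norm
        (u := fun k => c k * Real.exp (-(w.re - 1) / γ)) (hs.mul_right _)
        (fun k => (hdiffL k).mono inter_subset_left) hUo
      intro k v hv
      refine (hbd k v hv.1).trans ?_
      have := hv.2
      have h2 : w.re - 1 < v.re := hv.2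
      have := (hcpos k).le
      gcongr
    have hwU : w ∈ U := ⟨hw, by simp⟩
    have h2 : DifferentiableAt ℂ (fun w => ∑' k, L k w) w :=
      h1.differentiableAt (hUo.mem_nhds hwU)
    exact ((h2.const_mul _).cexp).differentiableWithinAt
  have hw0 : (⟨Real.log r - 1, 0⟩ : ℂ) ∈ logSectorB 0 γ r := by
    refine ⟨?_, ?_⟩
    · simp; positivity
    · simp
  refine Complex.exp_ne_zero _ (hQ f hdiff ⟨1, 1, one_pos, one_pos, ?_⟩ _ hw0)
  intro w hw p
  have hsum : Summable (fun k => L k w) :=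
    Summable.of_norm_bounded (hs.mul_right _) (fun k => hbd k w hw)
  have hsre : Summable (fun k => (L k w).re) := (Complex.hasSum_re hsum.hasSum).summable
  have hLre : ∀ k, (L k w).re = Real.log ‖1 + (c k : ℂ) * Complex.exp (-w / γ)‖ :=
    fun k => Complex.log_re _
  have hge : ∑ k ∈ Finset.range p, (L k w).re ≤ ∑' k, (L k w).re := by
    apply hsre.sum_le_tsum
    intro k _
    rw [hLre]
    exact Real.log_nonneg (wt_norm_ge_one (hre k w hw))
  have h1 : ‖f w‖ = Real.exp (-γ * ∑' k, (L k w).re) := by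
    rw [hf, Complex.norm_exp, ← Complex.ofReal_neg, Complex.re_ofReal_mul, Complex.re_tsum hsum]
  rw [h1]
  calc Real.exp (-γ * ∑' k, (L k w).re)
      ≤ Real.exp (-γ * ∑ k ∈ Finset.range p, (L k w).re) := by
        apply Real.exp_le_exp.2; nlinarith
    _ = ∏ k ∈ Finset.range p, Real.exp (-γ * (L k w).re) := by
        rw [Finset.mul_sum, Real.exp_sum]
    _ ≤ ∏ k ∈ Finset.range p, ((M (k + 1) / M k) * Real.exp w.re) := by
        apply Finset.prod_le_prod (fun _ _ => (Real.exp_pos _).le)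
        intro k _
        have h2 : c k * Real.exp (-w.re / γ) ≤ ‖1 + (c k : ℂ) * Complex.exp (-w / γ)‖ := by
          refine le_trans (le_of_eq ?_) (wt_norm_ge (hre k w hw))
          rw [norm_mul, Complex.norm_real, Real.norm_of_nonneg (hcpos k).le, hnormexp]
        have h3 := Real.log_le_log (mul_pos (hcpos k) (Real.exp_pos _)) h2
        rw [← hLre, Real.log_mul (hcpos k).ne' (Real.exp_pos _).ne', Real.log_exp, hc] at h3
        simp only at h3
        rw [Real.log_rpow (one_div_pos.2 (hm k)), one_div (M (k + 1) / M k), Real.log_inv] at h3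
        have h4 : -γ * (L k w).re ≤ Real.log (M (k + 1) / M k) + w.re := by
          have h5 := mul_le_mul_of_nonneg_left h3 hγ0.le
          have h6 : γ * (1 / γ * -Real.log (M (k + 1) / M k) + -w.re / γ)
            = -(Real.log (M (k + 1) / M k) + w.re) := by field_simp; ring
          linarith
        calc Real.exp (-γ * (L k w).re) ≤ _ := Real.exp_le_exp.2 h4
          _ = _ := by rw [Real.exp_add, Real.exp_log (hm k)]
    _ = 1 * 1 ^ p * M p * Real.exp w.re ^ p := by
        rw [Finset.prod_mul_distrib, wt_M_prod hM]; simp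

/-- The auxiliary multiplier `((1 + 2s + 2s²)/(1+s))^γ` on the right half-plane. -/
def wtPsi (γ : ℝ) (s : ℂ) : ℂ :=
  (1 + (1 + Complex.I) * s) ^ (γ : ℂ) * (1 + (1 - Complex.I) * s) ^ (γ : ℂ) /
    (1 + s) ^ (γ : ℂ)

lemma wtPsi_norm (γ : ℝ) (s : ℂ) :
    ‖wtPsi γ s‖ = (‖1 + 2 * s + 2 * s ^ 2‖ / ‖1 + s‖) ^ γ := by
  unfold wtPsi
  rw [norm_div, norm_mul, Complex.norm_cpow_real, Complex.norm_cpow_real, Complex.norm_cpow_real,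
    Real.div_rpow (norm_nonneg _) (norm_nonneg _), ← Real.mul_rpow (norm_nonneg _) (norm_nonneg _),
    ← norm_mul]
  congr 3
  ring_nf
  simp
  ring_nf

lemma wtPsi_diff (γ : ℝ) {s : ℂ} (hs : 0 ≤ s.re) : DifferentiableAt ℂ (wtPsi γ) s := by
  unfold wtPsi
  have h1 : 1 + s ∈ Complex.slitPlane := by
    left; simp; linarith
  have h2 : 1 + (1 + Complex.I) * s ∈ Complex.slitPlane := by
    by_cases h : (1 + (1 + Complex.I) * s).im = 0
    · left; simp at h ⊢; linarith
    · right; exact h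
  have h3 : 1 + (1 - Complex.I) * s ∈ Complex.slitPlane := by
    by_cases h : (1 + (1 - Complex.I) * s).im = 0
    · left; simp at h ⊢; linarith
    · right; exact h
  refine DifferentiableAt.div (DifferentiableAt.mul ?_ ?_) ?_ ?_
  · exact DifferentiableAt.cpow (by fun_prop) (by fun_prop) h2
  · exact DifferentiableAt.cpow (by fun_prop) (by fun_prop) h3
  · exact DifferentiableAt.cpow (by fun_prop) (by fun_prop) h1
  · rw [← norm_ne_zero_iff, Complex.norm_cpow_real]
    exact (Real.rpow_pos_of_pos (by linarith [wt_norm_ge_one hs]) _).ne'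

lemma wtPsi_interior {γ : ℝ} (hγ : 0 < γ) {s : ℂ} (hs : 0 ≤ s.re) :
    ‖wtPsi γ s‖ ≤ (1 + 2 * ‖s‖) ^ γ := by
  rw [wtPsi_norm]
  have h := wt_norm_ge_one hs
  apply Real.rpow_le_rpow (by positivity) _ hγ.le
  rw [div_le_iff₀ (by linarith)]
  calc ‖1 + 2 * s + 2 * s ^ 2‖ = ‖1 + 2 * s * (1 + s)‖ := by ring_nf
    _ ≤ 1 + 2 * ‖s‖ * ‖1 + s‖ := by
      refine (norm_add_le _ _).trans ?_
      simp
    _ ≤ _ := by nlinarith [norm_nonneg s]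

lemma wtPsi_boundary {γ : ℝ} (hγ : 0 < γ) (y : ℝ) :
    ‖wtPsi γ (y * Complex.I)‖ ≤ (max 1 (2 * |y|)) ^ γ := by
  rw [wtPsi_norm]
  have h : 1 ≤ ‖1 + (y : ℂ) * Complex.I‖ := wt_norm_ge_one (by simp)
  apply Real.rpow_le_rpow (by positivity) _ hγ.le
  rw [div_le_iff₀ (by linarith)]
  have e1 : ‖1 + 2 * ((y : ℂ) * Complex.I) + 2 * ((y : ℂ) * Complex.I) ^ 2‖ ^ 2
      = 1 + 4 * y ^ 4 := by
    rw [Complex.sq_norm, Complex.normSq_apply]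
    simp [pow_two]
    ring
  have e2 : ‖1 + (y : ℂ) * Complex.I‖ ^ 2 = 1 + y ^ 2 := by
    rw [Complex.sq_norm, Complex.normSq_apply]
    simp
    ring
  rw [← sq_le_sq₀ (norm_nonneg _) (by positivity), e1, mul_pow, e2]
  rcases le_total 1 (2 * |y|) with hy | hy
  · rw [max_eq_right hy, mul_pow, sq_abs]
    have : 1 ≤ 4 * y ^ 2 := by rw [← sq_abs]; nlinarith
    nlinarith
  · rw [max_eq_left hy]
    have : 4 * y ^ 2 ≤ 1 := by rw [← sq_abs]; nlinarith [abs_nonneg y]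
    nlinarith [sq_nonneg y]

lemma wtPsi_real {γ : ℝ} (hγ : 0 < γ) {x : ℝ} (hx : 0 ≤ x) :
    (1 + x) ^ γ ≤ ‖wtPsi γ x‖ := by
  rw [wtPsi_norm]
  apply Real.rpow_le_rpow (by positivity) _ hγ.le
  have h1 : ‖1 + 2 * (x : ℂ) + 2 * (x : ℂ) ^ 2‖ = 1 + 2 * x + 2 * x ^ 2 := by
    rw [show 1 + 2 * (x : ℂ) + 2 * (x : ℂ) ^ 2 = ((1 + 2 * x + 2 * x ^ 2 : ℝ) : ℂ) by push_cast; rfl,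
      Complex.norm_real, Real.norm_of_nonneg (by positivity)]
  have h2 : ‖1 + (x : ℂ)‖ = 1 + x := by
    rw [show 1 + (x : ℂ) = ((1 + x : ℝ) : ℂ) by push_cast; rfl,
      Complex.norm_real, Real.norm_of_nonneg (by positivity)]
  rw [h1, h2, le_div_iff₀ (by positivity)]
  nlinarith

lemma wt_choose {B : ℕ → ℝ} (hB : Monotone B) (hBp : ∀ k, 0 < B k) {t : ℝ} (ht : 0 < t) (P : ℕ) :
    ∃ q, (∏ k ∈ Finset.range q, (B k / t)) * ∏ k ∈ Finset.range P, max 1 (t / B k) ≤ 1 := by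
  induction P with
  | zero => exact ⟨0, by simp⟩
  | succ P ih =>
    rcases le_total t (B P) with h | h
    · obtain ⟨q, hq⟩ := ih
      refine ⟨q, ?_⟩
      rw [Finset.prod_range_succ, max_eq_left ((div_le_one (hBp P)).2 h), mul_one]
      exact hq
    · refine ⟨P + 1, ?_⟩
      rw [← Finset.prod_mul_distrib]
      apply le_of_eq
      apply Finset.prod_eq_one
      intro k hk
      have hk' : B k ≤ t := (hB (by simp at hk; omega)).trans h
      rw [max_eq_right ((one_le_div (hBp k)).2 hk')]
      have := hBp k
      field_simp

lemma wt_halfplane {γ : ℝ} (hγ : 0 < γ) {B : ℕ → ℝ} (hB : Monotone B) (hBp : ∀ k, 0 < B k)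
    {R C : ℝ} (hR : 0 < R) (hC : 0 < C) {G : ℂ → ℂ}
    (hG : ∀ z : ℂ, 0 ≤ z.re → DifferentiableAt ℂ G z)
    (hbd : ∀ z : ℂ, 0 ≤ z.re → ∀ q : ℕ,
      ‖G z‖ ≤ C * (∏ k ∈ Finset.range q, (B k / ‖z + R‖)) ^ γ)
    (P : ℕ) {x : ℝ} (hx : 0 ≤ x) :
    ‖G x‖ * (∏ k ∈ Finset.range P, (1 + x / (2 * B k))) ^ γ ≤ C := by
  have hRn : ∀ z : ℂ, 0 ≤ z.re → R ≤ ‖z + R‖ := fun z hz => by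
    have := Complex.re_le_norm (z + R)
    simp at this
    linarith
  have hzn : ∀ z : ℂ, 0 ≤ z.re → ‖z‖ ≤ ‖z + R‖ := fun z hz => by
    rw [← sq_le_sq₀ (norm_nonneg _) (norm_nonneg _), Complex.sq_norm, Complex.sq_norm,
      Complex.normSq_apply, Complex.normSq_apply]
    simp
    nlinarith
  have hsre : ∀ k, ∀ z : ℂ, 0 ≤ z.re → 0 ≤ (z / ((2 * B k : ℝ) : ℂ)).re := fun k z hz => by
    rw [Complex.div_ofReal_re]
    have := hBp k
    positivity
  have hsn : ∀ k, ∀ z : ℂ, ‖z / ((2 * B k : ℝ) : ℂ)‖ = ‖z‖ / (2 * B k) := fun k z => by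
    have := hBp k
    rw [norm_div, Complex.norm_real, Real.norm_of_nonneg (by positivity)]
  set H : ℂ → ℂ := fun z => G z * ∏ k ∈ Finset.range P, wtPsi γ (z / ((2 * B k : ℝ) : ℂ)) with hH
  have hHn : ∀ z, ‖H z‖ = ‖G z‖ * ∏ k ∈ Finset.range P, ‖wtPsi γ (z / ((2 * B k : ℝ) : ℂ))‖ :=
    fun z => by rw [hH, norm_mul, norm_prod]
  have hHd : ∀ z : ℂ, 0 ≤ z.re → DifferentiableAt ℂ H z := by
    intro z hz
    apply (hG z hz).mul
    apply DifferentiableAt.fun_finsetProd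
    intro k _
    exact DifferentiableAt.comp z (wtPsi_diff γ (hsre k z hz)) (by fun_prop)
  set K : ℝ := C * (∏ k ∈ Finset.range P, (B k * (1 / R + 1 / B k))) ^ γ with hK
  have hHK : ∀ z : ℂ, 0 ≤ z.re → ‖H z‖ ≤ K := by
    intro z hz
    have ht : 0 < ‖z + R‖ := hR.trans_le (hRn z hz)
    rw [hHn]
    calc _ ≤ (C * (∏ k ∈ Finset.range P, (B k / ‖z + R‖)) ^ γ) *
          ∏ k ∈ Finset.range P, (‖z + R‖ * (1 / R + 1 / B k)) ^ γ := by
          apply mul_le_mul (hbd z hz P)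
          · apply Finset.prod_le_prod (fun _ _ => norm_nonneg _)
            intro k _
            have hb := hBp k
            refine (wtPsi_interior hγ (hsre k z hz)).trans ?_
            apply Real.rpow_le_rpow (by positivity) _ hγ.le
            rw [hsn, mul_add]
            apply add_le_add
            · rw [mul_one_div, one_le_div hR]; exact hRn z hz
            · have : 2 * (‖z‖ / (2 * B k)) = ‖z‖ * (1 / B k) := by field_simp
              rw [this]
              have := hzn z hz
              gcongr
          · exact Finset.prod_nonneg (fun _ _ => norm_nonneg _)
          · have : 0 ≤ ∏ k ∈ Finset.range P, (B k / ‖z + R‖) :=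
              Finset.prod_nonneg (fun k _ => (div_pos (hBp k) ht).le)
            positivity
      _ = K := by
          rw [Real.finsetProd_rpow _ _ (fun k _ => by have := hBp k; positivity), mul_assoc,
            ← Real.mul_rpow, ← Finset.prod_mul_distrib, hK]
          · congr 2
            apply Finset.prod_congr rfl
            intro k _
            field_simp
          · exact Finset.prod_nonneg (fun k _ => (div_pos (hBp k) ht).le)
          · exact Finset.prod_nonneg (fun k _ => by have := hBp k; positivity)
  have hPL : ‖H x‖ ≤ C := by
    apply PhragmenLindelof.right_half_plane_of_bounded_on_real (f := H)
    · refine DifferentiableOn.diffContOnCl ?_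
      intro z hz
      have hz' : 0 ≤ z.re := by
        have : z ∈ closure {z : ℂ | 0 < z.re} := hz
        rwa [Complex.closure_setOfPred_lt_re] at this
      exact (hHd z hz').differentiableWithinAt
    · refine ⟨1, by norm_num, 0, ?_⟩
      apply Asymptotics.IsBigO.of_bound K
      apply Filter.mem_inf_of_right
      intro z hz
      have : 0 < z.re := hz
      simpa using hHK z this.le
    · refine ⟨K, ?_⟩
      simp only [eventually_map]
      filter_upwards [eventually_ge_atTop 0] with x hx
      exact hHK x (by simpa using hx)
    · intro y
      have hz : 0 ≤ ((y : ℂ) * Complex.I).re := by simp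
      have ht : 0 < ‖(y : ℂ) * Complex.I + R‖ := hR.trans_le (hRn _ hz)
      obtain ⟨q, hq⟩ := wt_choose hB hBp ht P
      have n1 : 0 ≤ ∏ k ∈ Finset.range q, (B k / ‖(y : ℂ) * Complex.I + R‖) :=
        Finset.prod_nonneg (fun k _ => (div_pos (hBp k) ht).le)
      have n2 : 0 ≤ ∏ k ∈ Finset.range P, max 1 (‖(y : ℂ) * Complex.I + R‖ / B k) :=
        Finset.prod_nonneg (fun k _ => le_max_of_le_left zero_le_one)
      rw [hHn]
      calc _ ≤ (C * (∏ k ∈ Finset.range q, (B k / ‖(y : ℂ) * Complex.I + R‖)) ^ γ) *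
            ∏ k ∈ Finset.range P, (max 1 (‖(y : ℂ) * Complex.I + R‖ / B k)) ^ γ := by
            apply mul_le_mul (hbd _ hz q)
            · apply Finset.prod_le_prod (fun _ _ => norm_nonneg _)
              intro k _
              have hb := hBp k
              have e : (y : ℂ) * Complex.I / ((2 * B k : ℝ) : ℂ)
                  = ((y / (2 * B k) : ℝ) : ℂ) * Complex.I := by
                push_cast; ring
              rw [e]
              refine (wtPsi_boundary hγ _).trans ?_
              apply Real.rpow_le_rpow (by positivity) _ hγ.le
              apply max_le_max le_rfl
              have e2 : 2 * |y / (2 * B k)| = |y| / B k := by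
                rw [abs_div, abs_of_pos (show 0 < 2 * B k by positivity)]; field_simp
              rw [e2]
              have h3 := hzn _ hz
              simp at h3
              gcongr
            · exact Finset.prod_nonneg (fun _ _ => norm_nonneg _)
            · positivity
        _ = C * ((∏ k ∈ Finset.range q, (B k / ‖(y : ℂ) * Complex.I + R‖)) *
              ∏ k ∈ Finset.range P, max 1 (‖(y : ℂ) * Complex.I + R‖ / B k)) ^ γ := by
            rw [Real.finsetProd_rpow _ _ (fun k _ => le_max_of_le_left zero_le_one), mul_assoc,
              ← Real.mul_rpow n1 n2]
        _ ≤ C * 1 := by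
            apply mul_le_mul_of_nonneg_left _ hC.le
            exact Real.rpow_le_one (mul_nonneg n1 n2) hq hγ.le
        _ = C := mul_one C
    · simpa using hx
  refine le_trans ?_ hPL
  rw [hHn, ← Real.finsetProd_rpow _ _ (fun k _ => by have := hBp k; positivity)]
  apply mul_le_mul_of_nonneg_left _ (norm_nonneg _)
  apply Finset.prod_le_prod
  · intro k _; have := hBp k; positivity
  · intro k _
    have hb := hBp k
    have := wtPsi_real hγ (x := x / (2 * B k)) (by positivity)
    push_cast at this ⊢
    exact this

lemma wt_sum_le_prod (u : ℕ → ℝ) (hu : ∀ k, 0 ≤ u k) (P : ℕ) :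
    ∑ k ∈ Finset.range P, u k ≤ ∏ k ∈ Finset.range P, (1 + u k) := by
  suffices h : 1 + ∑ k ∈ Finset.range P, u k ≤ ∏ k ∈ Finset.range P, (1 + u k) by linarith
  induction P with
  | zero => simp
  | succ P ih =>
    rw [Finset.sum_range_succ, Finset.prod_range_succ]
    have h1 := hu P
    have h2 : 0 ≤ ∑ k ∈ Finset.range P, u k := Finset.sum_nonneg (fun k _ => hu k)
    nlinarith

lemma wt_QA (M : ℕ → ℝ) (hM : GoodSeq M) (γ r : ℝ) (hγ0 : 0 < γ)
    (hs : ¬ Summable (fun p : ℕ => (1 / (M (p + 1) / M p)) ^ (1 / γ))) :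
    UniformQuasianalytic M (logSectorB 0 γ r) := by
  rintro f hf ⟨C, A, hC, hA, hbd⟩
  have hm : ∀ k, 0 < M (k + 1) / M k := fun k => div_pos (hM.2.1 _) (hM.2.1 _)
  have hmm : Monotone (fun k => M (k + 1) / M k) := by
    apply monotone_nat_of_le_succ
    intro k
    rw [div_le_div_iff₀ (hM.2.1 _) (hM.2.1 _)]
    nlinarith [hM.2.2.1 k]
  set B : ℕ → ℝ := fun k => (A * (M (k + 1) / M k)) ^ (1 / γ) with hBdef
  have hBp : ∀ k, 0 < B k := fun k => Real.rpow_pos_of_pos (mul_pos hA (hm k)) _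
  have hB : Monotone B := by
    intro i j hij
    have := hm i
    apply Real.rpow_le_rpow (by positivity) _ (by positivity)
    exact mul_le_mul_of_nonneg_left (hmm hij) hA.le
  set R : ℝ := Real.exp (-Real.log r / γ) + 1 with hRdef
  have hR : 0 < R := by positivity
  set φ : ℂ → ℂ := fun z => -(γ : ℂ) * Complex.log (z + R) with hφ
  have hRn : ∀ z : ℂ, 0 ≤ z.re → R ≤ ‖z + R‖ := fun z hz => by
    have := Complex.re_le_norm (z + R)
    simp only [Complex.add_re, Complex.ofReal_re] at this
    linarith
  have hφre : ∀ z, (φ z).re = -γ * Real.log ‖z + R‖ := fun z => by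
    simp only [hφ]
    rw [← Complex.ofReal_neg, Complex.re_ofReal_mul, Complex.log_re]
  have hφS : ∀ z : ℂ, 0 ≤ z.re → φ z ∈ logSectorB 0 γ r := by
    intro z hz
    refine ⟨?_, ?_⟩
    · have e : (φ z).im = -γ * Complex.arg (z + R) := by
        simp only [hφ]
        rw [← Complex.ofReal_neg, Complex.im_ofReal_mul, Complex.log_im]
      rw [e, sub_zero, abs_mul, abs_neg, abs_of_pos hγ0]
      have : |Complex.arg (z + R)| < π / 2 := by
        rw [Complex.abs_arg_lt_pi_div_two_iff]
        left
        simp only [Complex.add_re, Complex.ofReal_re]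
        linarith
      nlinarith
    · rw [hφre]
      have h1 : Real.exp (-Real.log r / γ) < ‖z + R‖ := by
        have := hRn z hz
        linarith
      have h2 := (Real.lt_log_iff_exp_lt (hR.trans_le (hRn z hz))).2 h1
      rw [div_lt_iff₀ hγ0] at h2
      linarith
  have hG : ∀ z : ℂ, 0 ≤ z.re → DifferentiableAt ℂ (fun z => f (φ z)) z := by
    intro z hz
    apply DifferentiableAt.comp z (g := f)
    · exact hf.differentiableAt ((wt_isOpen γ r).mem_nhds (hφS z hz))
    · apply DifferentiableAt.const_mul
      apply DifferentiableAt.clog (by fun_prop)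
      left
      simp only [Complex.add_re, Complex.ofReal_re]
      linarith
  have hGb : ∀ z : ℂ, 0 ≤ z.re → ∀ q : ℕ,
      ‖f (φ z)‖ ≤ C * (∏ k ∈ Finset.range q, (B k / ‖z + R‖)) ^ γ := by
    intro z hz q
    have ht : 0 < ‖z + R‖ := hR.trans_le (hRn z hz)
    refine (hbd _ (hφS z hz) q).trans (le_of_eq ?_)
    rw [← Real.finsetProd_rpow _ _ (fun k _ => (div_pos (hBp k) ht).le)]
    have e : ∀ k, (B k / ‖z + R‖) ^ γ = A * (M (k + 1) / M k) * Real.exp (φ z).re := by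
      intro k
      rw [Real.div_rpow (hBp k).le ht.le, hBdef]
      simp only
      rw [← Real.rpow_mul (mul_pos hA (hm k)).le, one_div_mul_cancel hγ0.ne', Real.rpow_one, hφre,
        Real.rpow_def_of_pos ht, div_eq_mul_inv, ← Real.exp_neg]
      congr 2
      ring
    simp only [e]
    rw [Finset.prod_mul_distrib, Finset.prod_mul_distrib, wt_M_prod hM]
    simp
    ring
  have hzero : ∀ x : ℝ, 0 < x → f (φ x) = 0 := by
    intro x hx
    have key : ∀ P, ‖f (φ x)‖ * (∏ k ∈ Finset.range P, (1 + x / (2 * B k))) ^ γ ≤ C := fun P =>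
      wt_halfplane hγ0 hB hBp hR hC hG hGb P hx.le
    have hns : ¬ Summable (fun k => x / (2 * B k)) := by
      intro h
      apply hs
      have h2 := h.mul_left (2 / x * A ^ (1 / γ))
      refine h2.congr ?_
      intro k
      have hb := hBp k
      have hb1 := Real.rpow_pos_of_pos (hm k) (1 / γ)
      have ha1 := Real.rpow_pos_of_pos hA (1 / γ)
      rw [hBdef]
      simp only
      rw [Real.mul_rpow hA.le (hm k).le, Real.div_rpow zero_le_one (hm k).le, Real.one_rpow]
      field_simp
    have hu : ∀ k, 0 ≤ x / (2 * B k) := fun k => by have := hBp k; positivity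
    have ht := (not_summable_iff_tendsto_nat_atTop_of_nonneg hu).1 hns
    have ht2 : Tendsto (fun P => ∏ k ∈ Finset.range P, (1 + x / (2 * B k))) atTop atTop :=
      tendsto_atTop_mono (fun P => wt_sum_le_prod _ hu P) ht
    have ht3 := (tendsto_rpow_atTop hγ0).comp ht2
    by_contra hne
    have hpos : 0 < ‖f (φ x)‖ := norm_pos_iff.2 hne
    have ht4 := ht3.const_mul_atTop hpos
    obtain ⟨P, hP⟩ := (ht4.eventually_gt_atTop C).exists
    exact absurd (key P) (not_le.2 hP)
  have hreal : ∀ u : ℝ, u < -γ * Real.log R → f (u : ℂ) = 0 := by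
    intro u hu
    have hx : R < Real.exp (-u / γ) := by
      rw [← Real.log_lt_iff_lt_exp hR, lt_div_iff₀ hγ0]
      linarith
    have := hzero (Real.exp (-u / γ) - R) (by linarith)
    have e : φ ((Real.exp (-u / γ) - R : ℝ) : ℂ) = u := by
      simp only [hφ]
      rw [← Complex.ofReal_add, sub_add_cancel, ← Complex.ofReal_log (Real.exp_pos _).le,
        Real.log_exp]
      push_cast
      have : (γ : ℂ) ≠ 0 := by exact_mod_cast hγ0.ne'
      field_simp
    rwa [e] at this
  set u0 : ℝ := -γ * Real.log R - 1 with hu0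
  have hu0S : (u0 : ℂ) ∈ logSectorB 0 γ r := by
    refine ⟨?_, ?_⟩
    · simp; positivity
    · have h1 := (hφS 0 le_rfl).2
      rw [hφre] at h1
      simp [abs_of_pos hR] at h1
      simp [hu0]
      linarith
  have han : AnalyticOnNhd ℂ f (logSectorB 0 γ r) := hf.analyticOnNhd (wt_isOpen γ r)
  have hfreq : ∃ᶠ z in 𝓝[≠] (u0 : ℂ), f z = 0 := by
    have htend : Tendsto (fun u : ℝ => (u : ℂ)) (𝓝[<] u0) (𝓝[≠] (u0 : ℂ)) := by
      apply tendsto_nhdsWithin_of_tendsto_nhds_of_eventually_within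
      · exact (Complex.continuous_ofReal.tendsto u0).mono_left nhdsWithin_le_nhds
      · filter_upwards [self_mem_nhdsWithin] with u hu
        have : u < u0 := hu
        simp [this.ne]
    apply htend.frequently
    apply Eventually.frequently
    filter_upwards [self_mem_nhdsWithin] with u hu
    have : u < u0 := hu
    exact hreal u (by linarith)
  intro w hw
  exact han.eqOn_zero_of_preconnected_of_frequently_eq_zero (wt_convex γ r).isPreconnected
    hu0S hfreq hw

/-- Remark 2.21 of the paper: for the bounded sector `S(0, γ, r)`, the
class `Ã^u_M(S(0,γ,r))` is quasianalytic if and only if `Σ (1/m_p)^{1/γ}` diverges. -/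
theorem watson_uniform_asymptotics_bounded_sector
    (M : ℕ → ℝ) (hM : GoodSeq M) (γ r : ℝ) (hγ0 : 0 < γ) (hr : 0 < r) :
    UniformQuasianalytic M (logSectorB 0 γ r) ↔
      ¬ Summable (fun p : ℕ => (1 / (M (p + 1) / M p)) ^ (1 / γ)) := by
  exact ⟨fun h hs => wt_nonQA M hM γ r hγ0 hs h, fun hs => wt_QA M hM γ r hγ0 hs⟩
end
end

section
/- Let M = (M_p) be a logarithmically convex sequence of positive reals with M_0 = 1 whose quotients m_p := M_{p+1}/M_p tend to infinity, and let γ > 0. If either γ < ω(M), or γ = ω(M) and the series Σ_{p≥0} (1/((p+1)·m_p))^{1/(ω(M)+1)} converges, then there exists a nonzero bounded holomorphic function f on the sector S_γ that admits a continuous extension to the boundary ∂S_γ and is M-flat in both boundary directions πγ/2 and −πγ/2. -/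
open Filter Topology Set
open scoped Real

noncomputable section

lemma aux_norm_log_le (x : ℂ) (hx : 0 ≤ x.re) : ‖Complex.log (1 + x)‖ ≤ ‖x‖ := by
  have hconv : Convex ℝ {z : ℂ | 0 ≤ z.re} := convex_halfSpace_re_ge 0
  have h := hconv.norm_image_sub_le_of_norm_hasDerivWithin_le
    (f := fun z : ℂ => Complex.log (1 + z)) (f' := fun z : ℂ => 1 / (1 + z)) (C := 1)
    (x := 0) (y := x) ?_ ?_ (by simp) hx
  · simpa using h
  · intro z hz
    have hz' : 0 ≤ z.re := hz
    refine (HasDerivAt.clog ((hasDerivAt_id z).const_add 1) ?_).hasDerivWithinAt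
    left
    simp
    linarith
  · intro z hz
    have hz' : 0 ≤ z.re := hz
    have h1 : 1 ≤ ‖1 + z‖ := by
      refine le_trans ?_ (Complex.re_le_norm _)
      simp
      exact hz'
    rw [norm_div, norm_one]
    rw [div_le_one (by linarith)]
    exact h1

lemma aux_summable (M : ℕ → ℝ) (hM : GoodSeq M) (γ : ℝ) (hγ0 : 0 < γ)
    (hcond : γ < omegaM M ∨ (γ = omegaM M ∧
      Summable (fun p : ℕ =>
        (1 / (((p : ℝ) + 1) * (M (p + 1) / M p))) ^ (1 / (omegaM M + 1))))) :
    Summable (fun p : ℕ => (M (p + 1) / M p) ^ (-(1 / γ))) := by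
  obtain ⟨h0, hpos, hlc, ht⟩ := hM
  have hm : ∀ p, 0 < M (p + 1) / M p := fun p => div_pos (hpos _) (hpos _)
  rcases hcond with h | ⟨h, hs⟩
  · rw [omegaM, Filter.liminf_eq] at h
    have hne : {a : ℝ | ∀ᶠ n : ℕ in atTop,
        a ≤ Real.log (M (n + 1) / M n) / Real.log (n : ℝ)}.Nonempty := by
      by_contra hne
      rw [Set.not_nonempty_iff_eq_empty] at hne
      rw [hne, Real.sSup_empty] at h
      linarith
    obtain ⟨β, hβ, hγβ⟩ := exists_lt_of_lt_csSup hne h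
    have hsum : Summable (fun p : ℕ => (p : ℝ) ^ (-(β / γ))) := by
      rw [Real.summable_nat_rpow]
      have : 1 < β / γ := by rwa [one_lt_div hγ0]
      linarith
    refine summable_of_isBigO_nat hsum ?_
    refine Asymptotics.IsBigO.of_bound 1 ?_
    have hβ' : ∀ᶠ n : ℕ in atTop,
        β ≤ Real.log (M (n + 1) / M n) / Real.log (n : ℝ) := hβ
    filter_upwards [hβ', eventually_ge_atTop 2] with p hp hp2
    have hp2' : (2 : ℝ) ≤ p := by exact_mod_cast hp2
    have hl : 0 < Real.log (p : ℝ) := Real.log_pos (by linarith)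
    rw [le_div_iff₀ hl] at hp
    rw [one_mul, Real.norm_of_nonneg (Real.rpow_nonneg (hm p).le _),
      Real.norm_of_nonneg (Real.rpow_nonneg (by linarith) _),
      Real.rpow_def_of_pos (hm p), Real.rpow_def_of_pos (by linarith)]
    apply Real.exp_le_exp.mpr
    have : β * Real.log p * (1 / γ) ≤ Real.log (M (p + 1) / M p) * (1 / γ) :=
      mul_le_mul_of_nonneg_right hp (by positivity)
    have e : Real.log (p : ℝ) * -(β / γ) = -(β * Real.log p * (1 / γ)) := by ring
    rw [e]
    linarith
  · rw [← h] at hs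
    set b : ℕ → ℝ := fun p : ℕ =>
        (1 / (((p : ℝ) + 1) * (M (p + 1) / M p))) ^ (1 / (γ + 1)) with hb
    have hmono : Monotone (fun p => M (p + 1) / M p) := by
      refine monotone_nat_of_le_succ fun p => ?_
      rw [div_le_div_iff₀ (hpos _) (hpos _)]
      nlinarith [hlc p]
    have hbpos : ∀ p, 0 < b p := by
      intro p
      have := hm p
      simp only [hb]
      positivity
    have hanti : Antitone b := by
      intro p q hpq
      simp only [hb]
      have h1 := hm p
      have h2 := hm q
      have h3 : M (p + 1) / M p ≤ M (q + 1) / M q := hmono hpq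
      have h4 : (p : ℝ) ≤ q := by exact_mod_cast hpq
      apply Real.rpow_le_rpow (by positivity) _ (by positivity)
      apply one_div_le_one_div_of_le (by positivity)
      exact mul_le_mul (by linarith) h3 h1.le (by positivity)
    have hS : ∀ p : ℕ, ((p : ℝ) + 1) * b p ≤ ∑' i, b i := by
      intro p
      calc ((p : ℝ) + 1) * b p = ∑ i ∈ Finset.range (p + 1), b p := by simp
        _ ≤ ∑ i ∈ Finset.range (p + 1), b i := by
            apply Finset.sum_le_sum
            intro i hi
            apply hanti
            have := Finset.mem_range.mp hi
            omega
        _ ≤ ∑' i, b i := hs.sum_le_tsum _ (fun i _ => (hbpos i).le)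
    refine Summable.of_nonneg_of_le (fun p => Real.rpow_nonneg (hm p).le _) ?_
      (hs.mul_left ((∑' i, b i) ^ (1 / γ)))
    intro p
    have key : (M (p + 1) / M p) ^ (-(1 / γ)) = (((p : ℝ) + 1) * b p) ^ (1 / γ) * b p := by
      have hp1 : (0 : ℝ) < (p : ℝ) + 1 := by positivity
      have hlb : Real.log (b p) =
          -(1 / (γ + 1)) * (Real.log ((p : ℝ) + 1) + Real.log (M (p + 1) / M p)) := by
        simp only [hb]
        rw [Real.log_rpow (by have := hm p; positivity), one_div (_ * _), Real.log_inv,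
          Real.log_mul hp1.ne' (hm p).ne']
        ring
      have hX : 0 < (((p : ℝ) + 1) * b p) := mul_pos hp1 (hbpos p)
      apply Real.log_injOn_pos (Real.rpow_pos_of_pos (hm p) _)
        (mul_pos (Real.rpow_pos_of_pos hX _) (hbpos p))
      rw [Real.log_rpow (hm p), Real.log_mul (Real.rpow_pos_of_pos hX _).ne' (hbpos p).ne',
        Real.log_rpow hX, Real.log_mul hp1.ne' (hbpos p).ne', hlb]
      have : γ + 1 ≠ 0 := by positivity
      field_simp
      ring
    rw [key]
    apply mul_le_mul_of_nonneg_right _ (hbpos p).le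
    apply Real.rpow_le_rpow (mul_nonneg (by positivity) (hbpos p).le) (hS p) (by positivity)

/-- Remark 4.4 of the paper, converse to Watson's lemmas: if
`γ < ω(M)`, or `γ = ω(M)` and `Σ (1/((p+1) m_p))^{1/(ω(M)+1)}` converges, then there is a
nontrivial bounded holomorphic function `f` on `S_γ`, with continuous extension `g` to the
closed sector, which is `M`-flat in both boundary directions `±πγ/2`. -/
theorem nontrivial_flat_function_exists
    (M : ℕ → ℝ) (hM : GoodSeq M) (γ : ℝ) (hγ0 : 0 < γ)
    (hcond : γ < omegaM M ∨ (γ = omegaM M ∧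
      Summable (fun p : ℕ =>
        (1 / (((p : ℝ) + 1) * (M (p + 1) / M p))) ^ (1 / (omegaM M + 1))))) :
    ∃ f g : ℂ → ℂ,
      DifferentiableOn ℂ f (logSector 0 γ) ∧
      (∃ K : ℝ, ∀ w ∈ logSector 0 γ, ‖f w‖ ≤ K) ∧
      ContinuousOn g {w : ℂ | |w.im| ≤ γ * π / 2} ∧
      (∀ w ∈ logSector 0 γ, g w = f w) ∧
      (∃ w ∈ logSector 0 γ, f w ≠ 0) ∧
      MFlatDir M g {w : ℂ | |w.im| ≤ γ * π / 2} (γ * π / 2) ∧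
      MFlatDir M g {w : ℂ | |w.im| ≤ γ * π / 2} (-(γ * π / 2)) := by
  have hsum := aux_summable M hM γ hγ0 hcond
  obtain ⟨h0, hpos, hlc, ht⟩ := hM
  have hm : ∀ p, 0 < M (p + 1) / M p := fun p => div_pos (hpos _) (hpos _)
  set a : ℕ → ℝ := fun p : ℕ => (M (p + 1) / M p) ^ (-(1 / γ)) with ha
  have hapos : ∀ p, 0 < a p := fun p => Real.rpow_pos_of_pos (hm p) _
  let x : ℕ → ℂ → ℂ := fun p w => (a p : ℂ) * Complex.exp (-w / γ)
  let L : ℕ → ℂ → ℂ := fun p w => Complex.log (1 + x p w)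
  let D : Set ℂ := {w : ℂ | |w.im| ≤ γ * π / 2}
  have hxnorm : ∀ p w, ‖x p w‖ = a p * Real.exp (-w.re / γ) := by
    intro p w
    have e : (-w / (γ : ℂ)).re = -w.re / γ := by
      rw [Complex.div_ofReal_re, Complex.neg_re]
    simp only [x]
    rw [norm_mul, Complex.norm_real, Real.norm_of_nonneg (hapos p).le, Complex.norm_exp, e]
  have hxre : ∀ p, ∀ w ∈ D, 0 ≤ (x p w).re := by
    intro p w hw
    have hw' : |w.im| ≤ γ * π / 2 := hw
    have e : (-w / (γ : ℂ)).im = -w.im / γ := by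
      rw [Complex.div_ofReal_im, Complex.neg_im]
    simp only [x]
    rw [Complex.re_ofReal_mul, Complex.exp_re, e]
    refine mul_nonneg (hapos p).le (mul_nonneg (Real.exp_pos _).le ?_)
    rw [abs_le] at hw'
    apply Real.cos_nonneg_of_neg_pi_div_two_le_of_le
    · rw [le_div_iff₀ hγ0]
      linarith
    · rw [div_le_iff₀ hγ0]
      linarith
  have hslit : ∀ p, ∀ w ∈ D, 1 + x p w ∈ Complex.slitPlane := by
    intro p w hw
    left
    have := hxre p w hw
    rw [Complex.add_re, Complex.one_re]
    linarith
  have hLb : ∀ p, ∀ w ∈ D, ‖L p w‖ ≤ a p * Real.exp (-w.re / γ) := by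
    intro p w hw
    rw [← hxnorm]
    exact aux_norm_log_le _ (hxre p w hw)
  have hLs : ∀ w ∈ D, Summable (fun p => L p w) := fun w hw =>
    Summable.of_norm_bounded (hsum.mul_right _) (fun p => hLb p w hw)
  have hLd : ∀ p, ∀ w ∈ D, DifferentiableAt ℂ (L p) w := by
    intro p w hw
    have : DifferentiableAt ℂ (fun w => 1 + x p w) w := by
      simp only [x]
      fun_prop
    exact this.clog (hslit p w hw)
  let f : ℂ → ℂ := fun w => Complex.exp (-(γ : ℂ) * ∑' p, L p w)
  have hbR : ∀ R : ℝ, ∀ p, ∀ w ∈ D, R < w.re → ‖L p w‖ ≤ a p * Real.exp (-R / γ) := by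
    intro R p w hw hR
    refine (hLb p w hw).trans (mul_le_mul_of_nonneg_left (Real.exp_le_exp.mpr ?_) (hapos p).le)
    gcongr
  have hSD : logSector 0 γ ⊆ D := by
    intro w hw
    have : |w.im - 0| < γ * π / 2 := hw
    rw [sub_zero] at this
    exact this.le
  have hSo : IsOpen (logSector 0 γ) := by
    apply isOpen_lt <;> fun_prop
  have hfd : DifferentiableOn ℂ f (logSector 0 γ) := by
    intro w hw
    let U : Set ℂ := logSector 0 γ ∩ {v : ℂ | w.re - 1 < v.re}
    have hU : IsOpen U := hSo.inter (isOpen_lt continuous_const Complex.continuous_re)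
    have hwU : w ∈ U := ⟨hw, by simp⟩
    have hd : DifferentiableOn ℂ (fun v => ∑' p, L p v) U :=
      Complex.differentiableOn_tsum_of_summable_norm (hsum.mul_right (Real.exp (-(w.re - 1) / γ)))
        (fun p v hv => (hLd p v (hSD hv.1)).differentiableWithinAt) hU
        (fun p v hv => hbR _ p v (hSD hv.1) hv.2)
    have hda := hd.differentiableAt (hU.mem_nhds hwU)
    exact ((hda.const_mul (-(γ : ℂ))).cexp).differentiableWithinAt
  have hfc : ContinuousOn f D := by
    intro w hw
    let V : Set ℂ := {v : ℂ | w.re - 1 < v.re}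
    have hV : IsOpen V := isOpen_lt continuous_const Complex.continuous_re
    have hwV : w ∈ V := by simp [V]
    have hc : ContinuousOn (fun v => ∑' p, L p v) (D ∩ V) :=
      continuousOn_tsum (fun p v hv => (hLd p v hv.1).continuousAt.continuousWithinAt)
        (hsum.mul_right (Real.exp (-(w.re - 1) / γ)))
        (fun p v hv => hbR _ p v hv.1 hv.2)
    have h1 := hc w ⟨hw, hwV⟩
    have h2 : ContinuousWithinAt (fun v => ∑' p, L p v) D w :=
      (continuousWithinAt_inter (hV.mem_nhds hwV)).mp h1
    exact (continuousWithinAt_const.mul h2).cexp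
  have hflat : ∀ w ∈ D, ∀ p : ℕ, ‖f w‖ ≤ M p * Real.exp w.re ^ p := by
    intro w hw p
    have hre : (-(γ : ℂ) * ∑' p, L p w).re = -γ * ∑' p, (L p w).re := by
      rw [← Complex.ofReal_neg, Complex.re_ofReal_mul, Complex.re_tsum (hLs w hw)]
    have hLre : ∀ q, (L q w).re = Real.log ‖1 + x q w‖ := fun q => Complex.log_re _
    have hge1 : ∀ q, 1 ≤ ‖1 + x q w‖ := by
      intro q
      refine le_trans ?_ (Complex.re_le_norm _)
      have := hxre q w hw
      rw [Complex.add_re, Complex.one_re]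
      linarith
    have hge2 : ∀ q, ‖x q w‖ ≤ ‖1 + x q w‖ := by
      intro q
      have := hxre q w hw
      rw [Complex.norm_def, Complex.norm_def]
      apply Real.sqrt_le_sqrt
      simp only [Complex.normSq_apply, Complex.add_re, Complex.add_im, Complex.one_re,
        Complex.one_im]
      nlinarith
    have hsre : Summable (fun q => (L q w).re) := (Complex.hasSum_re (hLs w hw).hasSum).summable
    have hs1 : ∑ q ∈ Finset.range p, (L q w).re ≤ ∑' q, (L q w).re := by
      apply hsre.sum_le_tsum
      intro q _
      rw [hLre]
      exact Real.log_nonneg (hge1 q)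
    have hs2 : ∀ q, -(1 / γ) * Real.log (M (q + 1) / M q) + -w.re / γ ≤ (L q w).re := by
      intro q
      rw [hLre]
      have hx0 : 0 < ‖x q w‖ := by
        rw [hxnorm]
        exact mul_pos (hapos q) (Real.exp_pos _)
      refine le_trans (le_of_eq ?_) (Real.log_le_log hx0 (hge2 q))
      rw [hxnorm, Real.log_mul (hapos q).ne' (Real.exp_pos _).ne', Real.log_exp]
      simp only [ha]
      rw [Real.log_rpow (hm q)]
    have hprod : ∀ p, ∑ q ∈ Finset.range p, Real.log (M (q + 1) / M q) = Real.log (M p) := by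
      intro p
      have : ∀ q, Real.log (M (q + 1) / M q) = Real.log (M (q + 1)) - Real.log (M q) :=
        fun q => Real.log_div (hpos _).ne' (hpos _).ne'
      simp only [this]
      rw [Finset.sum_range_sub (fun q => Real.log (M q)), h0, Real.log_one, sub_zero]
    have hs3 : -(1 / γ) * Real.log (M p) + p * (-w.re / γ) ≤ ∑' q, (L q w).re := by
      refine le_trans (le_of_eq ?_) ((Finset.sum_le_sum (fun q _ => hs2 q)).trans hs1)
      rw [Finset.sum_add_distrib, ← Finset.mul_sum, hprod]
      simp
    have hfin : M p * Real.exp w.re ^ p = Real.exp (Real.log (M p) + p * w.re) := by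
      rw [Real.exp_add, Real.exp_log (hpos p), Real.exp_nat_mul]
    rw [hfin]
    simp only [f]
    rw [Complex.norm_exp, hre]
    apply Real.exp_le_exp.mpr
    have h5 := mul_le_mul_of_nonneg_left hs3 hγ0.le
    have e : γ * (-(1 / γ) * Real.log (M p) + p * (-w.re / γ)) =
        -(Real.log (M p) + p * w.re) := by
      field_simp
      ring
    rw [e] at h5
    linarith
  have hγπ : 0 < γ * π / 2 := by positivity
  have hdir : ∀ θ : ℝ, |θ| ≤ γ * π / 2 → MFlatDir M f D θ := by
    intro θ hθ
    refine ⟨1, 1, 1, one_pos, one_pos, one_pos, fun _ _ => hθ, ?_⟩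
    intro y _ p
    have := hflat ⟨y, θ⟩ hθ p
    simpa using this
  refine ⟨f, f, hfd, ⟨1, ?_⟩, hfc, fun _ _ => rfl, ⟨0, ?_, Complex.exp_ne_zero _⟩,
    hdir _ ?_, hdir _ ?_⟩
  · intro w hw
    have := hflat w (hSD hw) 0
    simpa [h0] using this
  · simpa [logSector] using hγπ
  · rw [abs_of_pos hγπ]
  · rw [abs_neg, abs_of_pos hγπ]
end
end
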